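/- (Multiplicative inequality (2.1).) There is a universal constant c > 0 such that for every v ∈ L_∞(-1,0;L₂(B)) ∩ L₂(-1,0;W¹₂(B)) and all radii 0 < r ≤ ϱ ≤ 1 one has C(r) ≤ c [ (ϱ/r)³ A^{3/4}(ϱ) E^{3/4}(ϱ) + (r/ϱ)³ A^{3/2}(ϱ) ]. -/

import Mathlib

open MeasureTheory Metric Set

noncomputable section

/-- Three-dimensional Euclidean space. -/
abbrev E3 := EuclideanSpace ℝ (Fin 3)

/-- The open ball `B(r) ⊆ ℝ³` of radius `r` centered at the origin. -/
def ballB (r : ℝ) : Set E3 := Metric.ball (0 : E3) r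

/-- The time interval `(-r², 0)`. -/
def timeI (r : ℝ) : Set ℝ := Set.Ioo (-r ^ 2) 0

/-- The parabolic cylinder `Q(r) = B(r) × (-r², 0)`. -/
def QSet (r : ℝ) : Set (E3 × ℝ) := ballB r ×ˢ timeI r

/-- The mean value `[f]_{B(r)}` of a function over the ball `B(r)`. -/
def avgB (r : ℝ) (f : E3 → ℝ) : ℝ := ⨍ x in ballB r, f x

/-- `A(r) = ess sup_{-r²<t<0} (1/r) ∫_{B(r)} |v(x,t)|² dx`. -/
def funA (v : E3 → ℝ → E3) (r : ℝ) : ℝ :=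
  essSup (fun t => (1 / r) * ∫ x in ballB r, ‖v x t‖ ^ 2)
    (volume.restrict (timeI r))

/-- `E(r) = (1/r) ∫_{Q(r)} |∇v|² dz`, where `gv` is the (weak) spatial gradient of `v`. -/
def funE (gv : E3 → ℝ → Fin 3 → Fin 3 → ℝ) (r : ℝ) : ℝ :=
  (1 / r) * ∫ t in timeI r, ∫ x in ballB r, ∑ i, ∑ j, (gv x t i j) ^ 2

/-- `C(r) = (1/r²) ∫_{Q(r)} |v|³ dz`. -/
def funC (v : E3 → ℝ → E3) (r : ℝ) : ℝ :=
  (1 / r ^ 2) * ∫ t in timeI r, ∫ x in ballB r, ‖v x t‖ ^ 3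

/-- `D₀(r) = (1/r²) ∫_{Q(r)} |p - [p]_{B(r)}|^{3/2} dz`. -/
def funD0 (p : E3 → ℝ → ℝ) (r : ℝ) : ℝ :=
  (1 / r ^ 2) * ∫ t in timeI r, ∫ x in ballB r,
    |p x t - avgB r (fun y => p y t)| ^ ((3 : ℝ) / 2)

/-- The `j`-th spatial coordinate direction in space-time `ℝ³ × ℝ`. -/
def spaceDir (j : Fin 3) : E3 × ℝ := (EuclideanSpace.single j (1 : ℝ), 0)

/-- The time direction in space-time `ℝ³ × ℝ`. -/
def timeDir : E3 × ℝ := (0, 1)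

/-- The spatial Laplacian of a space-time test function. -/
def lapSpace (φ : E3 × ℝ → ℝ) (z : E3 × ℝ) : ℝ :=
  ∑ j, fderiv ℝ (fun w => fderiv ℝ φ w (spaceDir j)) z (spaceDir j)

/-- `gv` is the weak spatial gradient of `v` on `B(ϱ)`, for a.e. time in `(-ϱ², 0)`:
integration by parts against smooth test functions compactly supported in `B(ϱ)`. -/
def IsWeakSpatialGradient (v : E3 → ℝ → E3) (gv : E3 → ℝ → Fin 3 → Fin 3 → ℝ)
    (ϱ : ℝ) : Prop :=
  ∀ᵐ t ∂(volume.restrict (timeI ϱ)),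
    ∀ φ : E3 → ℝ, ContDiff ℝ (⊤ : ℕ∞) φ → tsupport φ ⊆ ballB ϱ →
      ∀ i j, ∫ x in ballB ϱ, v x t i * fderiv ℝ φ x (EuclideanSpace.single j (1 : ℝ))
        = - ∫ x in ballB ϱ, gv x t i j * φ x

/-- The regularity class `v ∈ L_∞(-ϱ²,0;L₂(B(ϱ))) ∩ L₂(-ϱ²,0;W¹₂(B(ϱ)))`,
with weak spatial gradient `gv ∈ L₂(Q(ϱ))`. -/
structure VelocityClass (v : E3 → ℝ → E3) (gv : E3 → ℝ → Fin 3 → Fin 3 → ℝ)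
    (ϱ : ℝ) : Prop where
  v_meas : AEMeasurable (fun z : E3 × ℝ => v z.1 z.2) (volume.restrict (QSet ϱ))
  v_L2 : IntegrableOn (fun z : E3 × ℝ => ‖v z.1 z.2‖ ^ 2) (QSet ϱ)
  v_Linfty : ∃ M : ℝ, ∀ᵐ t ∂(volume.restrict (timeI ϱ)),
      (∫ x in ballB ϱ, ‖v x t‖ ^ 2) ≤ M
  grad_L2 : IntegrableOn (fun z : E3 × ℝ => ∑ i, ∑ j, (gv z.1 z.2 i j) ^ 2) (QSet ϱ)
  isGrad : IsWeakSpatialGradient v gv ϱ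

/-- The Navier–Stokes equations hold in `Q = Q(1)` in the sense of distributions. -/
def NSEDistrib (v : E3 → ℝ → E3) (gv : E3 → ℝ → Fin 3 → Fin 3 → ℝ)
    (p : E3 → ℝ → ℝ) : Prop :=
  (∀ φ : E3 × ℝ → E3, ContDiff ℝ (⊤ : ℕ∞) φ → tsupport φ ⊆ QSet 1 →
    (∫ z in QSet 1,
      ((∑ i, v z.1 z.2 i * fderiv ℝ (fun w => φ w i) z timeDir)
        + (∑ i, ∑ j, v z.1 z.2 i * v z.1 z.2 j * fderiv ℝ (fun w => φ w i) z (spaceDir j))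
        - (∑ i, ∑ j, gv z.1 z.2 i j * fderiv ℝ (fun w => φ w i) z (spaceDir j))
        + p z.1 z.2 * (∑ i, fderiv ℝ (fun w => φ w i) z (spaceDir i)))) = 0)
  ∧
  (∀ q : E3 × ℝ → ℝ, ContDiff ℝ (⊤ : ℕ∞) q → tsupport q ⊆ QSet 1 →
    (∫ z in QSet 1, ∑ i, v z.1 z.2 i * fderiv ℝ q z (spaceDir i)) = 0)

/-- The parabolic boundary of `Q = B(1) × (-1,0)`. -/
def parabBdry : Set (E3 × ℝ) :=
  (Metric.sphere (0 : E3) 1 ×ˢ Set.Icc (-1 : ℝ) 0)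
    ∪ (Metric.closedBall (0 : E3) 1 ×ˢ {(-1 : ℝ)})

/-- The local energy inequality for a suitable weak solution on `Q = Q(1)`. -/
def LocalEnergyIneq (v : E3 → ℝ → E3) (gv : E3 → ℝ → Fin 3 → Fin 3 → ℝ)
    (p : E3 → ℝ → ℝ) : Prop :=
  ∀ᵐ t ∂(volume.restrict (Set.Ioo (-1 : ℝ) 0)),
    ∀ φ : E3 × ℝ → ℝ, ContDiff ℝ (⊤ : ℕ∞) φ → (∀ z, 0 ≤ φ z) →
      (∃ U : Set (E3 × ℝ), IsOpen U ∧ parabBdry ⊆ U ∧ ∀ z ∈ U, φ z = 0) →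
      (∫ x in ballB 1, φ (x, t) * ‖v x t‖ ^ 2)
        + 2 * ∫ s in Set.Ioo (-1 : ℝ) t, ∫ x in ballB 1,
            φ (x, s) * ∑ i, ∑ j, (gv x s i j) ^ 2
      ≤ ∫ s in Set.Ioo (-1 : ℝ) t, ∫ x in ballB 1,
          (‖v x s‖ ^ 2 * (lapSpace φ (x, s) + fderiv ℝ φ (x, s) timeDir)
            + (∑ i, v x s i * fderiv ℝ φ (x, s) (spaceDir i)) * (‖v x s‖ ^ 2 + 2 * p x s))

/-- `(v, p)` is a suitable weak solution of the Navier–Stokes equations in `Q = Q(1)`,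
with `gv` the weak spatial gradient of `v`. -/
structure SuitableWeakSolution (v : E3 → ℝ → E3) (gv : E3 → ℝ → Fin 3 → Fin 3 → ℝ)
    (p : E3 → ℝ → ℝ) : Prop where
  vel : VelocityClass v gv 1
  p_meas : AEMeasurable (fun z : E3 × ℝ => p z.1 z.2) (volume.restrict (QSet 1))
  p_L32 : IntegrableOn (fun z : E3 × ℝ => |p z.1 z.2| ^ ((3 : ℝ) / 2)) (QSet 1)
  nse : NSEDistrib v gv p
  lei : LocalEnergyIneq v gv p

open scoped ENNReal NNReal

/-- Cauchy–Schwarz for the Lebesgue integral. -/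
lemma sq_lintegral_mul_le {α : Type*} [MeasurableSpace α] {μ : Measure α} {f g : α → ℝ≥0∞}
    (hf : AEMeasurable f μ) (hg : AEMeasurable g μ) :
    (∫⁻ a, f a * g a ∂μ) ^ 2 ≤ (∫⁻ a, f a ^ 2 ∂μ) * ∫⁻ a, g a ^ 2 ∂μ := by
  have h := ENNReal.lintegral_mul_le_Lp_mul_Lq μ Real.HolderConjugate.two_two hf hg
  simp only [Pi.mul_apply, ENNReal.rpow_two] at h
  calc _ ≤ _ := pow_le_pow_left' h 2
    _ = _ := by
      rw [mul_pow, ← ENNReal.rpow_two, ← ENNReal.rpow_two, ← ENNReal.rpow_mul, ← ENNReal.rpow_mul]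
      norm_num

lemma sq_lintegral_le {α : Type*} [MeasurableSpace α] {μ : Measure α} {f : α → ℝ≥0∞}
    (hf : AEMeasurable f μ) :
    (∫⁻ a, f a ∂μ) ^ 2 ≤ μ univ * ∫⁻ a, f a ^ 2 ∂μ := by
  simpa using sq_lintegral_mul_le (μ := μ) (f := fun _ => 1) aemeasurable_const hf

lemma enorm_sub_sq_le {F : Type*} [SeminormedAddCommGroup F] (a b : F) :
    ‖a - b‖ₑ ^ 2 ≤ 2 * ‖a‖ₑ ^ 2 + 2 * ‖b‖ₑ ^ 2 := by
  have h := ENNReal.rpow_add_le_mul_rpow_add_rpow ‖a‖ₑ ‖b‖ₑ (p := 2) (by norm_num)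
  norm_num at h
  calc ‖a - b‖ₑ ^ 2 ≤ (‖a‖ₑ + ‖b‖ₑ) ^ 2 := pow_le_pow_left' enorm_sub_le 2
    _ ≤ _ := h
    _ = _ := by ring

lemma lintegral_comp_smul_add {F : E3 → ℝ≥0∞} (hF : Measurable F) {c : ℝ} (hc : 0 < c) (b : E3) :
    ∫⁻ x, F (c • x + b) = ENNReal.ofReal ((c ^ 3)⁻¹) * ∫⁻ x, F x := by
  have h1 : ∫⁻ x, F (c • x + b) = ∫⁻ y, F (y + b) ∂(Measure.map (fun x : E3 => c • x) volume) := by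
    rw [lintegral_map (by fun_prop) (by fun_prop)]
  rw [h1, Measure.map_addHaar_smul _ hc.ne', lintegral_smul_measure,
    lintegral_add_right_eq_self F b]
  have : |(c ^ 3)⁻¹| = (c ^ 3)⁻¹ := abs_of_pos (by positivity)
  simp [this]

lemma lintegral_ball_comp_smul_add_le {F : E3 → ℝ≥0∞} (hF : Measurable F) {c R : ℝ} (hc : 0 < c)
    {b : E3} (hb : ∀ x ∈ ball (0 : E3) R, c • x + b ∈ ball (0 : E3) R) :
    ∫⁻ x in ball 0 R, F (c • x + b) ≤ ENNReal.ofReal ((c ^ 3)⁻¹) * ∫⁻ x in ball 0 R, F x := by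
  rw [← lintegral_indicator measurableSet_ball, ← lintegral_indicator measurableSet_ball,
    ← lintegral_comp_smul_add (hF.indicator measurableSet_ball) hc b]
  refine lintegral_mono fun x => ?_
  by_cases hx : x ∈ ball (0 : E3) R
  · simp only [indicator_of_mem hx, indicator_of_mem (hb x hx), le_refl]
  · simp [indicator_of_notMem hx]

lemma enorm_sub_sq_le_lintegral_fderiv {u : E3 → ℝ} (hu : ContDiff ℝ 1 u) (x y : E3) {δ : ℝ}
    (hδ : 0 ≤ δ) :
    ‖u x - u ((1 - δ) • x + δ • y)‖ₑ ^ 2 ≤ ENNReal.ofReal δ * ‖y - x‖ₑ ^ 2 *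
      ∫⁻ s in Ioc 0 δ, ‖fderiv ℝ u ((1 - s) • x + s • y)‖ₑ ^ 2 := by
  have hcd : Continuous (fderiv ℝ u) := hu.continuous_fderiv (by norm_num)
  have hcont : Continuous fun s : ℝ => fderiv ℝ u ((1 - s) • x + s • y) := by fun_prop
  have hder : ∀ s : ℝ, HasDerivAt (fun s : ℝ => u ((1 - s) • x + s • y))
      (fderiv ℝ u ((1 - s) • x + s • y) (y - x)) s := by
    intro s
    have h1 : HasDerivAt (fun s : ℝ => (1 - s) • x + s • y) (y - x) s := by
      have := (((hasDerivAt_const s (1 : ℝ)).sub (hasDerivAt_id s)).smul_const x).add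
        ((hasDerivAt_id s).smul_const y)
      exact this.congr_deriv (by simp [sub_eq_neg_add])
    exact ((hu.differentiable (by norm_num)) _).hasFDerivAt.comp_hasDerivAt s h1
  have hftc := intervalIntegral.integral_eq_sub_of_hasDerivAt (a := 0) (b := δ)
    (fun s _ => hder s) ((hcont.clm_apply continuous_const).intervalIntegrable _ _)
  have h2 : ‖u x - u ((1 - δ) • x + δ • y)‖ₑ ≤
      ∫⁻ s in Ioc 0 δ, ‖fderiv ℝ u ((1 - s) • x + s • y)‖ₑ * ‖y - x‖ₑ := by
    have : u x - u ((1 - δ) • x + δ • y) =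
        -∫ s in (0 : ℝ)..δ, fderiv ℝ u ((1 - s) • x + s • y) (y - x) := by
      rw [hftc]; simp
    rw [this, enorm_neg, intervalIntegral.integral_of_le hδ]
    refine (enorm_integral_le_lintegral_enorm _).trans (lintegral_mono fun s => ?_)
    exact ContinuousLinearMap.le_opENorm _ _
  rw [lintegral_mul_const _ (by fun_prop)] at h2
  calc _ ≤ _ := pow_le_pow_left' h2 2
    _ = (∫⁻ s in Ioc 0 δ, ‖fderiv ℝ u ((1 - s) • x + s • y)‖ₑ) ^ 2 * ‖y - x‖ₑ ^ 2 := mul_pow ..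
    _ ≤ (volume.restrict (Ioc 0 δ) univ *
          ∫⁻ s in Ioc 0 δ, ‖fderiv ℝ u ((1 - s) • x + s • y)‖ₑ ^ 2) * ‖y - x‖ₑ ^ 2 := by
      gcongr; exact sq_lintegral_le (by fun_prop)
    _ = _ := by simp; ring

lemma smul_add_smul_mem_ball {R s : ℝ} (hs : s ∈ Icc (0 : ℝ) 1) {x y : E3}
    (hx : x ∈ ball (0 : E3) R) (hy : y ∈ ball (0 : E3) R) :
    (1 - s) • x + s • y ∈ ball (0 : E3) R :=
  convex_ball _ _ hx hy (by linarith [hs.2]) hs.1 (by ring)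

/-- Averaged translation estimate along segments inside a ball. -/
lemma lintegral_lintegral_enorm_sub_sq_le {u : E3 → ℝ} (hu : ContDiff ℝ 1 u) {R δ : ℝ}
    (hR : 0 < R) (hδ : 0 ≤ δ) (hδ' : δ ≤ 1 / 2) :
    ∫⁻ x in ball (0 : E3) R, ∫⁻ y in ball (0 : E3) R, ‖u x - u ((1 - δ) • x + δ • y)‖ₑ ^ 2 ≤
      ENNReal.ofReal (32 * δ ^ 2 * R ^ 2) * volume (ball (0 : E3) R) *
        ∫⁻ x in ball (0 : E3) R, ‖fderiv ℝ u x‖ₑ ^ 2 := by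
  have hcd : Continuous (fderiv ℝ u) := hu.continuous_fderiv (by norm_num)
  set D := ∫⁻ x in ball (0 : E3) R, ‖fderiv ℝ u x‖ₑ ^ 2 with hD
  set K : ℝ≥0∞ := ENNReal.ofReal δ * ENNReal.ofReal (2 * R) ^ 2 with hK
  have hpt : ∀ x ∈ ball (0 : E3) R, ∀ y ∈ ball (0 : E3) R,
      ‖u x - u ((1 - δ) • x + δ • y)‖ₑ ^ 2 ≤
        K * ∫⁻ s in Ioc 0 δ, ‖fderiv ℝ u ((1 - s) • x + s • y)‖ₑ ^ 2 := by
    intro x hx y hy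
    refine (enorm_sub_sq_le_lintegral_fderiv hu x y hδ).trans ?_
    rw [hK]
    gcongr
    rw [← ofReal_norm]
    apply ENNReal.ofReal_le_ofReal
    have h1 := norm_sub_le y x
    rw [mem_ball_zero_iff] at hx hy
    linarith
  calc _ ≤ ∫⁻ x in ball (0 : E3) R, ∫⁻ y in ball (0 : E3) R,
        K * ∫⁻ s in Ioc 0 δ, ‖fderiv ℝ u ((1 - s) • x + s • y)‖ₑ ^ 2 :=
        setLIntegral_mono' measurableSet_ball fun x hx =>
          setLIntegral_mono' measurableSet_ball fun y hy => hpt x hx y hy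
    _ = K * ∫⁻ x in ball (0 : E3) R, ∫⁻ y in ball (0 : E3) R,
        ∫⁻ s in Ioc 0 δ, ‖fderiv ℝ u ((1 - s) • x + s • y)‖ₑ ^ 2 := by
      have hKt : K ≠ ∞ := by simp [hK, ENNReal.mul_eq_top]
      rw [← lintegral_const_mul' _ _ hKt]
      refine lintegral_congr fun x => ?_
      rw [lintegral_const_mul' _ _ hKt]
    _ = K * ∫⁻ y in ball (0 : E3) R, ∫⁻ s in Ioc 0 δ, ∫⁻ x in ball (0 : E3) R,
        ‖fderiv ℝ u ((1 - s) • x + s • y)‖ₑ ^ 2 := by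
      have hm : Measurable fun p : (E3 × E3) × ℝ =>
          ‖fderiv ℝ u ((1 - p.2) • p.1.1 + p.2 • p.1.2)‖ₑ ^ 2 := by
        have : Continuous fun p : (E3 × E3) × ℝ =>
          fderiv ℝ u ((1 - p.2) • p.1.1 + p.2 • p.1.2) := by fun_prop
        exact this.measurable.enorm.pow_const 2
      rw [lintegral_lintegral_swap (Measurable.aemeasurable hm.lintegral_prod_right')]
      congr 1
      refine lintegral_congr fun y => ?_
      rw [lintegral_lintegral_swap]
      exact (hm.comp (by fun_prop : Measurable fun q : E3 × ℝ => ((q.1, y), q.2))).aemeasurable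
    _ ≤ K * ∫⁻ y in ball (0 : E3) R, ∫⁻ s in Ioc 0 δ, ENNReal.ofReal 8 * D := by
      refine mul_le_mul' le_rfl <| setLIntegral_mono' measurableSet_ball fun y hy =>
        setLIntegral_mono' measurableSet_Ioc fun s hs => ?_
      have hs2 : (1 : ℝ) / 2 ≤ 1 - s := by linarith [hs.2]
      refine (lintegral_ball_comp_smul_add_le (F := fun z => ‖fderiv ℝ u z‖ₑ ^ 2)
        (by fun_prop) (by linarith) (b := s • y) fun x hx =>
          smul_add_smul_mem_ball ⟨hs.1.le, by linarith⟩ hx hy).trans ?_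
      have h8 : ((1 - s) ^ 3)⁻¹ ≤ (8 : ℝ) := by
        calc ((1 - s) ^ 3)⁻¹ ≤ ((1 / 2 : ℝ) ^ 3)⁻¹ := by gcongr
          _ = 8 := by norm_num
      exact mul_le_mul' (ENNReal.ofReal_le_ofReal h8) le_rfl
    _ = _ := by
      simp only [lintegral_const, Measure.restrict_apply_univ, Real.volume_Ioc, sub_zero, hK]
      rw [show (32 * δ ^ 2 * R ^ 2 : ℝ) = δ * (2 * R) ^ 2 * (8 * δ) by ring,
        ENNReal.ofReal_mul (p := δ * (2 * R) ^ 2) (by positivity), ENNReal.ofReal_mul (p := δ) hδ,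
        ENNReal.ofReal_pow (by positivity), ENNReal.ofReal_mul (p := 8) (by norm_num)]
      ring

lemma volume_ball_ne_zero {R : ℝ} (hR : 0 < R) : volume (ball (0 : E3) R) ≠ 0 :=
  (measure_ball_pos volume 0 hR).ne'

lemma lintegral_lintegral_enorm_sub_sq_le_fderiv {u : E3 → ℝ} (hu : ContDiff ℝ 1 u) {R : ℝ}
    (hR : 0 < R) :
    ∫⁻ x in ball (0 : E3) R, ∫⁻ y in ball (0 : E3) R, ‖u x - u y‖ₑ ^ 2 ≤
      ENNReal.ofReal (32 * R ^ 2) * volume (ball (0 : E3) R) *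
        ∫⁻ x in ball (0 : E3) R, ‖fderiv ℝ u x‖ₑ ^ 2 := by
  have hc := hu.continuous
  have key := lintegral_lintegral_enorm_sub_sq_le hu hR (δ := 1 / 2) (by norm_num) le_rfl
  set J : E3 → E3 → ℝ≥0∞ := fun x y => ‖u x - u ((1 - 1 / 2 : ℝ) • x + (1 / 2 : ℝ) • y)‖ₑ ^ 2
  have hJ : Measurable fun p : E3 × E3 => J p.1 p.2 := by
    have : Continuous fun p : E3 × E3 =>
      u p.1 - u ((1 - 1 / 2 : ℝ) • p.1 + (1 / 2 : ℝ) • p.2) := by fun_prop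
    exact this.measurable.enorm.pow_const 2
  have hpt : ∀ x y, ‖u x - u y‖ₑ ^ 2 ≤ 2 * J x y + 2 * J y x := by
    intro x y
    have := enorm_sub_sq_le (u x - u ((1 - 1 / 2 : ℝ) • x + (1 / 2 : ℝ) • y))
      (u y - u ((1 - 1 / 2 : ℝ) • y + (1 / 2 : ℝ) • x))
    have e : (1 - 1 / 2 : ℝ) • y + (1 / 2 : ℝ) • x = (1 - 1 / 2 : ℝ) • x + (1 / 2 : ℝ) • y := by
      module
    simpa only [J, e, sub_sub_sub_cancel_right] using this
  calc _ ≤ ∫⁻ x in ball (0 : E3) R, ∫⁻ y in ball (0 : E3) R, (2 * J x y + 2 * J y x) :=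
        lintegral_mono fun x => lintegral_mono fun y => hpt x y
    _ = 2 * (∫⁻ x in ball (0 : E3) R, ∫⁻ y in ball (0 : E3) R, J x y) +
        2 * ∫⁻ x in ball (0 : E3) R, ∫⁻ y in ball (0 : E3) R, J y x := by
      rw [← lintegral_const_mul' _ _ (by simp), ← lintegral_const_mul' _ _ (by simp),
        ← lintegral_add_left (by exact (hJ.lintegral_prod_right').const_mul 2)]
      refine lintegral_congr fun x => ?_
      rw [lintegral_add_left (by fun_prop), lintegral_const_mul' _ _ (by simp),
        lintegral_const_mul' _ _ (by simp)]
    _ = 4 * ∫⁻ x in ball (0 : E3) R, ∫⁻ y in ball (0 : E3) R, J x y := by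
      rw [lintegral_lintegral_swap (f := fun x y => J y x) (by
        exact (hJ.comp measurable_swap).aemeasurable)]
      ring
    _ ≤ 4 * _ := mul_le_mul' le_rfl key
    _ = _ := by
      rw [show (32 * R ^ 2 : ℝ) = 4 * (32 * (1 / 2) ^ 2 * R ^ 2) by ring,
        ENNReal.ofReal_mul (p := 4) (by norm_num)]
      rw [ENNReal.ofReal_ofNat]
      ring

/-- Poincaré's inequality on a ball, with the mean value also controlled. -/
lemma exists_poincare_const {u : E3 → ℝ} (hu : ContDiff ℝ 1 u) {R : ℝ} (hR : 0 < R) :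
    ∃ a : ℝ, volume (ball (0 : E3) R) * ‖a‖ₑ ^ 2 ≤ ∫⁻ x in ball (0 : E3) R, ‖u x‖ₑ ^ 2 ∧
      ∫⁻ x in ball (0 : E3) R, ‖u x - a‖ₑ ^ 2 ≤
        ENNReal.ofReal (32 * R ^ 2) * ∫⁻ x in ball (0 : E3) R, ‖fderiv ℝ u x‖ₑ ^ 2 := by
  have hc := hu.continuous
  have hV0 := volume_ball_ne_zero hR
  have hVt : volume (ball (0 : E3) R) ≠ ∞ := measure_ball_lt_top.ne
  have hint : IntegrableOn u (ball (0 : E3) R) :=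
    (hc.continuousOn.integrableOn_compact (isCompact_closedBall 0 R)).mono_set
      ball_subset_closedBall
  set V := volume (ball (0 : E3) R) with hV
  have hVr : 0 < V.toReal := ENNReal.toReal_pos hV0 hVt
  have hVe : ‖V.toReal‖ₑ = V := by
    rw [Real.enorm_eq_ofReal hVr.le, ENNReal.ofReal_toReal hVt]
  have hgen : ∀ (h : E3 → ℝ) (m : ℝ), Continuous h → V.toReal * m = ∫ x in ball (0 : E3) R, h x →
      V * ‖m‖ₑ ^ 2 ≤ ∫⁻ x in ball (0 : E3) R, ‖h x‖ₑ ^ 2 := by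
    intro h m hh hm
    have h1 : V * ‖m‖ₑ ≤ ∫⁻ x in ball (0 : E3) R, ‖h x‖ₑ := by
      rw [← hVe, ← enorm_mul, hm]
      exact enorm_integral_le_lintegral_enorm _
    have h2 := (pow_le_pow_left' h1 2).trans
      (sq_lintegral_le (μ := volume.restrict (ball (0 : E3) R)) (by fun_prop))
    rw [Measure.restrict_apply_univ, ← hV, mul_pow, sq V, mul_assoc] at h2
    exact (ENNReal.mul_le_mul_iff_right hV0 hVt).1 h2
  refine ⟨V.toReal⁻¹ * ∫ x in ball (0 : E3) R, u x, hgen u _ hc (by field_simp), ?_⟩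
  set a := V.toReal⁻¹ * ∫ x in ball (0 : E3) R, u x with ha
  have h3 : V * ∫⁻ x in ball (0 : E3) R, ‖u x - a‖ₑ ^ 2 ≤
      ∫⁻ x in ball (0 : E3) R, ∫⁻ y in ball (0 : E3) R, ‖u x - u y‖ₑ ^ 2 := by
    rw [← lintegral_const_mul' _ _ hVt]
    refine lintegral_mono fun x => hgen (fun y => u x - u y) _ (by fun_prop) ?_
    have : IsFiniteMeasure (volume.restrict (ball (0 : E3) R)) :=
      ⟨by rw [Measure.restrict_apply_univ]; exact measure_ball_lt_top⟩
    rw [integral_sub (integrable_const _) hint, setIntegral_const, ha, mul_sub,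
      measureReal_def, ← hV]
    field_simp
    simp
  have h4 := h3.trans (lintegral_lintegral_enorm_sub_sq_le_fderiv hu hR)
  rw [mul_comm (ENNReal.ofReal _) (volume _), ← hV, mul_assoc] at h4
  exact (ENNReal.mul_le_mul_iff_right hV0 hVt).1 h4

/-- Distribution function estimate on a ball. -/
lemma volume_lt_abs_mul_sq_le {w : E3 → ℝ} (hw : ContDiff ℝ 1 w) {R δ l : ℝ} (hR : 0 < R)
    (hδ : 0 < δ) (hδ' : δ ≤ 1 / 2) (hl : 0 < l)
    (h : 4 * ∫⁻ x in ball (0 : E3) R, ‖w x‖ₑ ^ 2 ≤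
      volume (ball (0 : E3) R) * ENNReal.ofReal (δ ^ 3 * l ^ 2)) :
    volume.restrict (ball (0 : E3) R) {x | l < |w x|} * ENNReal.ofReal (l ^ 2) ≤
      ENNReal.ofReal (128 * δ ^ 2 * R ^ 2) * ∫⁻ x in ball (0 : E3) R, ‖fderiv ℝ w x‖ₑ ^ 2 := by
  have hc := hw.continuous
  have hm := hc.measurable
  have hV0 := volume_ball_ne_zero hR
  have hVt : volume (ball (0 : E3) R) ≠ ∞ := measure_ball_lt_top.ne
  have key := lintegral_lintegral_enorm_sub_sq_le hw hR hδ.le hδ'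
  set V := volume (ball (0 : E3) R) with hV
  set N := ∫⁻ x in ball (0 : E3) R, ‖w x‖ₑ ^ 2 with hN
  set J : E3 → ℝ≥0∞ := fun x => ∫⁻ y in ball (0 : E3) R, ‖w x - w ((1 - δ) • x + δ • y)‖ₑ ^ 2
    with hJ
  have hpt : ∀ x ∈ ball (0 : E3) R, l < |w x| → V * ENNReal.ofReal (l ^ 2) ≤ 4 * J x := by
    intro x hx hlx
    have h1 : ENNReal.ofReal (l ^ 2) ≤ ‖w x‖ₑ ^ 2 := by
      rw [Real.enorm_eq_ofReal_abs, ENNReal.ofReal_pow hl.le]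
      gcongr
    have h2 : ∫⁻ y in ball (0 : E3) R, ‖w ((1 - δ) • x + δ • y)‖ₑ ^ 2 ≤
        ENNReal.ofReal ((δ ^ 3)⁻¹) * N := by
      have := lintegral_ball_comp_smul_add_le (F := fun z => ‖w z‖ₑ ^ 2) (R := R)
        (by fun_prop) hδ (b := (1 - δ) • x) fun y hy => by
          rw [add_comm]; exact smul_add_smul_mem_ball ⟨hδ.le, by linarith⟩ hx hy
      simpa only [add_comm] using this
    have h3 : V * ENNReal.ofReal (l ^ 2) ≤ 2 * J x + 2 * (ENNReal.ofReal ((δ ^ 3)⁻¹) * N) := by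
      calc V * ENNReal.ofReal (l ^ 2) = ∫⁻ y in ball (0 : E3) R, ENNReal.ofReal (l ^ 2) := by
            simp [hV, mul_comm]
        _ ≤ ∫⁻ y in ball (0 : E3) R, (2 * ‖w x - w ((1 - δ) • x + δ • y)‖ₑ ^ 2 +
              2 * ‖w ((1 - δ) • x + δ • y)‖ₑ ^ 2) := by
          refine lintegral_mono fun y => h1.trans ?_
          have := enorm_sub_sq_le (w x - w ((1 - δ) • x + δ • y)) (-w ((1 - δ) • x + δ • y))
          simpa using this
        _ = 2 * J x + 2 * ∫⁻ y in ball (0 : E3) R, ‖w ((1 - δ) • x + δ • y)‖ₑ ^ 2 := by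
          rw [lintegral_add_left (by fun_prop), lintegral_const_mul' _ _ (by simp),
            lintegral_const_mul' _ _ (by simp)]
        _ ≤ _ := by gcongr
    have h4 : 4 * (ENNReal.ofReal ((δ ^ 3)⁻¹) * N) ≤ V * ENNReal.ofReal (l ^ 2) := by
      calc 4 * (ENNReal.ofReal ((δ ^ 3)⁻¹) * N) = ENNReal.ofReal ((δ ^ 3)⁻¹) * (4 * N) := by ring
        _ ≤ ENNReal.ofReal ((δ ^ 3)⁻¹) * (V * ENNReal.ofReal (δ ^ 3 * l ^ 2)) := by gcongr
        _ = V * ENNReal.ofReal (l ^ 2) := by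
          rw [mul_left_comm, ← ENNReal.ofReal_mul (by positivity)]
          congr 2
          field_simp
    have hXt : V * ENNReal.ofReal (l ^ 2) ≠ ∞ := ENNReal.mul_ne_top hVt ENNReal.ofReal_ne_top
    have h5 : V * ENNReal.ofReal (l ^ 2) + V * ENNReal.ofReal (l ^ 2) ≤
        4 * J x + V * ENNReal.ofReal (l ^ 2) := by
      calc _ ≤ 2 * (2 * J x + 2 * (ENNReal.ofReal ((δ ^ 3)⁻¹) * N)) := by rw [← two_mul]; gcongr
        _ = 4 * J x + 4 * (ENNReal.ofReal ((δ ^ 3)⁻¹) * N) := by ring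
        _ ≤ _ := by gcongr
    exact (ENNReal.add_le_add_iff_right hXt).1 h5
  have hS : MeasurableSet {x | l < |w x|} := measurableSet_lt measurable_const (by fun_prop)
  have h6 : V * (volume.restrict (ball (0 : E3) R) {x | l < |w x|} * ENNReal.ofReal (l ^ 2)) ≤
      V * (ENNReal.ofReal (128 * δ ^ 2 * R ^ 2) *
        ∫⁻ x in ball (0 : E3) R, ‖fderiv ℝ w x‖ₑ ^ 2) := by
    calc _ = ∫⁻ x in ball (0 : E3) R ∩ {x | l < |w x|}, V * ENNReal.ofReal (l ^ 2) := by
          rw [lintegral_const, Measure.restrict_apply_univ, Measure.restrict_apply hS, inter_comm]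
          ring
      _ ≤ ∫⁻ x in ball (0 : E3) R ∩ {x | l < |w x|}, 4 * J x :=
        setLIntegral_mono' (measurableSet_ball.inter hS) fun x hx => hpt x hx.1 hx.2
      _ ≤ ∫⁻ x in ball (0 : E3) R, 4 * J x := lintegral_mono_set inter_subset_left
      _ = 4 * ∫⁻ x in ball (0 : E3) R, J x := lintegral_const_mul' _ _ (by simp)
      _ ≤ 4 * _ := mul_le_mul' le_rfl key
      _ = _ := by
        rw [show 128 * δ ^ 2 * R ^ 2 = 4 * (32 * δ ^ 2 * R ^ 2) by ring,
          ENNReal.ofReal_mul (p := 4) (by norm_num)]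
        rw [ENNReal.ofReal_ofNat]
        ring
  exact (ENNReal.mul_le_mul_iff_right hV0 hVt).1 h6

/-- Interpolation: an `L²` bound and a weak `L^{10/3}` bound give an `L³` bound. -/
lemma lintegral_enorm_cube_le {α : Type*} [MeasurableSpace α] {μ : Measure α} {f : α → ℝ}
    (hf : AEMeasurable f μ) {L N H : ℝ} (hL : 0 < L) (hN : 0 ≤ N) (hH : 0 ≤ H)
    (h2 : ∫⁻ x, ‖f x‖ₑ ^ 2 ∂μ ≤ ENNReal.ofReal N)
    (hw : ∀ l, L ≤ l →
      μ {x | l < |f x|} * ENNReal.ofReal (l ^ 2) ≤ ENNReal.ofReal (H * l ^ (-4 / 3 : ℝ))) :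
    ∫⁻ x, ‖f x‖ₑ ^ 3 ∂μ ≤ ENNReal.ofReal (3 * (L * N) + 9 * H * L ^ (-1 / 3 : ℝ)) := by
  have hcake := lintegral_rpow_eq_lintegral_meas_lt_mul μ (f := fun x => |f x|)
    (Filter.Eventually.of_forall fun x => abs_nonneg _) (by fun_prop) (p := 3) (by norm_num)
  have e1 : ∫⁻ x, ‖f x‖ₑ ^ 3 ∂μ = ∫⁻ x, ENNReal.ofReal (|f x| ^ (3 : ℝ)) ∂μ := by
    refine lintegral_congr fun x => ?_
    rw [Real.enorm_eq_ofReal_abs, ← ENNReal.ofReal_pow (abs_nonneg _)]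
    norm_cast
  have e2 : ∀ t : ℝ, t ^ (3 - 1 : ℝ) = t ^ 2 := fun t => by norm_num
  rw [e1, hcake]
  simp only [e2]
  have hlow : ∫⁻ t in Ioc 0 L, μ {x | t < |f x|} * ENNReal.ofReal (t ^ 2) ≤
      ENNReal.ofReal (L * N) := by
    calc _ ≤ ∫⁻ _ in Ioc 0 L, ENNReal.ofReal N := by
          refine setLIntegral_mono' measurableSet_Ioc fun t ht => ?_
          refine le_trans ?_ h2
          rw [mul_comm]
          refine le_trans ?_ (mul_meas_ge_le_lintegral₀ (by fun_prop) (ENNReal.ofReal (t ^ 2)))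
          gcongr with x
          intro hx
          rw [Real.enorm_eq_ofReal_abs, ← ENNReal.ofReal_pow (abs_nonneg _)]
          have h0 := ht.1
          exact ENNReal.ofReal_le_ofReal (by gcongr)
      _ = _ := by
          rw [lintegral_const, Measure.restrict_apply_univ, Real.volume_Ioc, sub_zero,
            mul_comm L, ENNReal.ofReal_mul hN]
  have hhigh : ∫⁻ t in Ioi L, μ {x | t < |f x|} * ENNReal.ofReal (t ^ 2) ≤
      ENNReal.ofReal (3 * H * L ^ (-1 / 3 : ℝ)) := by
    have hi : IntegrableOn (fun t : ℝ => t ^ (-4 / 3 : ℝ)) (Ioi L) :=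
      integrableOn_Ioi_rpow_of_lt (by norm_num) hL
    calc _ ≤ ∫⁻ t in Ioi L, ENNReal.ofReal (H * t ^ (-4 / 3 : ℝ)) :=
          setLIntegral_mono' measurableSet_Ioi fun t ht => hw t (le_of_lt ht)
      _ = ENNReal.ofReal (∫ t in Ioi L, H * t ^ (-4 / 3 : ℝ)) := by
          rw [ofReal_integral_eq_lintegral_ofReal (hi.const_mul H)]
          refine (ae_restrict_mem measurableSet_Ioi).mono fun t ht => ?_
          have : 0 < t := hL.trans ht
          simp only [Pi.zero_apply]
          positivity
      _ = _ := by
          rw [integral_const_mul, integral_Ioi_rpow_of_lt (by norm_num) hL]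
          norm_num
          ring_nf
  rw [← Ioc_union_Ioi_eq_Ioi hL.le, lintegral_union measurableSet_Ioi
    (Ioc_disjoint_Ioi le_rfl)]
  calc _ ≤ ENNReal.ofReal 3 *
        (ENNReal.ofReal (L * N) + ENNReal.ofReal (3 * H * L ^ (-1 / 3 : ℝ))) := by gcongr
    _ = _ := by
      rw [← ENNReal.ofReal_add (by positivity) (by positivity),
        ← ENNReal.ofReal_mul (by norm_num)]
      congr 1
      ring

lemma lintegral_ball_enorm_sq_ne_top {F : Type*} [NormedAddCommGroup F] {h : E3 → F}
    (hh : Continuous h) (R : ℝ) : ∫⁻ x in ball (0 : E3) R, ‖h x‖ₑ ^ 2 ≠ ∞ := by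
  have hi : IntegrableOn (fun x => ‖h x‖ ^ 2) (ball (0 : E3) R) :=
    ((by fun_prop : Continuous fun x => ‖h x‖ ^ 2).continuousOn.integrableOn_compact
      (isCompact_closedBall 0 R)).mono_set ball_subset_closedBall
  have := hi.2
  rw [hasFiniteIntegral_iff_enorm] at this
  simpa [enorm_pow] using this.ne

lemma exists_volume_ball_eq : ∃ b : ℝ, 0 < b ∧
    ∀ R : ℝ, 0 < R → volume (ball (0 : E3) R) = ENNReal.ofReal (b * R ^ 3) := by
  refine ⟨(volume (ball (0 : E3) 1)).toReal,
    ENNReal.toReal_pos (volume_ball_ne_zero one_pos) measure_ball_lt_top.ne, fun R hR => ?_⟩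
  rw [Measure.addHaar_ball _ _ hR.le, ENNReal.ofReal_mul ENNReal.toReal_nonneg,
    ENNReal.ofReal_toReal measure_ball_lt_top.ne, finrank_euclideanSpace_fin, mul_comm]

/-- Gagliardo–Nirenberg–Poincaré inequality on balls for `C¹` functions. -/
lemma exists_gagliardo_nirenberg_const : ∃ C : ℝ, 0 < C ∧ ∀ u : E3 → ℝ, ContDiff ℝ 1 u →
    ∀ R : ℝ, 0 < R → ∃ a : ℝ,
      volume (ball (0 : E3) R) * ‖a‖ₑ ^ 2 ≤ ∫⁻ x in ball (0 : E3) R, ‖u x‖ₑ ^ 2 ∧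
      ∫⁻ x in ball (0 : E3) R, ‖u x - a‖ₑ ^ 3 ≤ ENNReal.ofReal C *
        ((∫⁻ x in ball (0 : E3) R, ‖u x‖ₑ ^ 2) ^ (3 / 4 : ℝ) *
          (∫⁻ x in ball (0 : E3) R, ‖fderiv ℝ u x‖ₑ ^ 2) ^ (3 / 4 : ℝ)) := by
  obtain ⟨b, hb0, hVR⟩ := exists_volume_ball_eq
  obtain ⟨e, he1, he⟩ : ∃ e : ℝ, 1 ≤ e ∧ 4 ≤ b * e ^ 3 := by
    refine ⟨1 + 4 / b, by simp; positivity, ?_⟩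
    have h1 : (1 : ℝ) ≤ 1 + 4 / b := by simp; positivity
    calc (4 : ℝ) ≤ b * (1 + 4 / b) := by field_simp; linarith
      _ ≤ b * (1 + 4 / b) ^ 3 := by gcongr; exact le_self_pow₀ h1 (by norm_num)
  have he0 : 0 < e := by linarith
  obtain ⟨k, hk1, hk⟩ : ∃ k : ℝ, 1 ≤ k ∧ 12 * e ≤ k ^ 2 :=
    ⟨12 * e, by linarith, by nlinarith⟩
  have hk0 : 0 < k := by linarith
  refine ⟨(3 * k ^ 3 + 1152 * e ^ 2 / k) * 4, by positivity, fun u hu R hR => ?_⟩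
  obtain ⟨a, ha1, ha2⟩ := exists_poincare_const hu hR
  refine ⟨a, ha1, ?_⟩
  have hw : ContDiff ℝ 1 fun x => u x - a := hu.sub contDiff_const
  have hfd : ∀ x, fderiv ℝ (fun x => u x - a) x = fderiv ℝ u x := fun x => fderiv_sub_const _
  have hNt := lintegral_ball_enorm_sq_ne_top hw.continuous R
  have hDt := lintegral_ball_enorm_sq_ne_top (hu.continuous_fderiv (by norm_num)) R
  have hN4 : ∫⁻ x in ball (0 : E3) R, ‖u x - a‖ₑ ^ 2 ≤
      4 * ∫⁻ x in ball (0 : E3) R, ‖u x‖ₑ ^ 2 := by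
    have hm := hu.continuous.measurable
    calc _ ≤ ∫⁻ x in ball (0 : E3) R, (2 * ‖u x‖ₑ ^ 2 + 2 * ‖a‖ₑ ^ 2) :=
          lintegral_mono fun x => enorm_sub_sq_le _ _
      _ = 2 * (∫⁻ x in ball (0 : E3) R, ‖u x‖ₑ ^ 2) +
          2 * (volume (ball (0 : E3) R) * ‖a‖ₑ ^ 2) := by
        rw [lintegral_add_left (by fun_prop), lintegral_const_mul' _ _ (by simp), lintegral_const,
          Measure.restrict_apply_univ]
        ring
      _ ≤ 2 * (∫⁻ x in ball (0 : E3) R, ‖u x‖ₑ ^ 2) +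
          2 * ∫⁻ x in ball (0 : E3) R, ‖u x‖ₑ ^ 2 := by gcongr
      _ = _ := by ring
  set N := ∫⁻ x in ball (0 : E3) R, ‖u x - a‖ₑ ^ 2 with hN
  set D := ∫⁻ x in ball (0 : E3) R, ‖fderiv ℝ u x‖ₑ ^ 2 with hD
  suffices hmain : ∫⁻ x in ball (0 : E3) R, ‖u x - a‖ₑ ^ 3 ≤
      ENNReal.ofReal (3 * k ^ 3 + 1152 * e ^ 2 / k) * (N ^ (3 / 4 : ℝ) * D ^ (3 / 4 : ℝ)) by
    refine hmain.trans ?_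
    rw [ENNReal.ofReal_mul (by positivity), mul_assoc]
    refine mul_le_mul' le_rfl ?_
    rw [← mul_assoc]
    refine mul_le_mul' ?_ le_rfl
    calc N ^ (3 / 4 : ℝ) ≤ (4 * ∫⁻ x in ball (0 : E3) R, ‖u x‖ₑ ^ 2) ^ (3 / 4 : ℝ) := by gcongr
      _ = 4 ^ (3 / 4 : ℝ) * (∫⁻ x in ball (0 : E3) R, ‖u x‖ₑ ^ 2) ^ (3 / 4 : ℝ) :=
        ENNReal.mul_rpow_of_nonneg _ _ (by norm_num)
      _ ≤ 4 ^ (1 : ℝ) * (∫⁻ x in ball (0 : E3) R, ‖u x‖ₑ ^ 2) ^ (3 / 4 : ℝ) := by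
        gcongr <;> norm_num
      _ = _ := by simp
  by_cases hN0 : N = 0
  · have h0 := (lintegral_eq_zero_iff (by
      have := hw.continuous.measurable
      fun_prop)).1 hN0
    have : ∫⁻ x in ball (0 : E3) R, ‖u x - a‖ₑ ^ 3 = 0 := by
      rw [← lintegral_zero (μ := volume.restrict (ball (0 : E3) R))]
      refine lintegral_congr_ae (h0.mono fun x hx => ?_)
      simpa using hx
    rw [this]
    exact zero_le
  have hD0 : D ≠ 0 := fun h => hN0 (by simpa [h] using ha2)
  obtain ⟨p, hp0, hp⟩ : ∃ p : ℝ, 0 < p ∧ N = ENNReal.ofReal (p ^ 12) := by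
    have : 0 < N.toReal := ENNReal.toReal_pos hN0 hNt
    refine ⟨N.toReal ^ (1 / 12 : ℝ), by positivity, ?_⟩
    rw [← Real.rpow_natCast, ← Real.rpow_mul this.le]
    norm_num [ENNReal.ofReal_toReal hNt]
  obtain ⟨q, hq0, hq⟩ : ∃ q : ℝ, 0 < q ∧ D = ENNReal.ofReal (q ^ 4) := by
    have : 0 < D.toReal := ENNReal.toReal_pos hD0 hDt
    refine ⟨D.toReal ^ (1 / 4 : ℝ), by positivity, ?_⟩
    rw [← Real.rpow_natCast, ← Real.rpow_mul this.le]
    norm_num [ENNReal.ofReal_toReal hDt]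
  have hpq : p ^ 6 ≤ 6 * R * q ^ 2 := by
    rw [hp, hq, ← ENNReal.ofReal_mul (by positivity),
      ENNReal.ofReal_le_ofReal_iff (by positivity)] at ha2
    refine le_of_sq_le_sq ?_ (by positivity)
    nlinarith [sq_nonneg (R * q ^ 2)]
  have hcube := lintegral_enorm_cube_le (μ := volume.restrict (ball (0 : E3) R))
    (f := fun x => u x - a) hw.continuous.measurable.aemeasurable (L := (k * q / p) ^ 3)
    (N := p ^ 12) (H := 128 * e ^ 2 * p ^ 8 * q ^ 4) (by positivity) (by positivity)
    (by positivity) hp.le fun l hl => by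
      have hl0 : 0 < l := lt_of_lt_of_le (by positivity) hl
      obtain ⟨m, hm0, rfl⟩ : ∃ m : ℝ, 0 < m ∧ l = m ^ 3 := by
        refine ⟨l ^ (1 / 3 : ℝ), by positivity, ?_⟩
        rw [← Real.rpow_natCast, ← Real.rpow_mul hl0.le]
        norm_num
      have hm : k * q / p ≤ m := le_of_pow_le_pow_left₀ (by norm_num) hm0.le hl
      rw [div_le_iff₀ hp0] at hm
      have hδ : e * p ^ 4 / (R * m ^ 2) ≤ 1 / 2 := by
        rw [div_le_div_iff₀ (by positivity) (by norm_num)]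
        have h1 : (k * q) ^ 2 ≤ (m * p) ^ 2 := by gcongr
        have h2 : p ^ 2 * (e * p ^ 4 * 2) ≤ p ^ 2 * (1 * (R * m ^ 2)) := by
          calc p ^ 2 * (e * p ^ 4 * 2) = 2 * e * p ^ 6 := by ring
            _ ≤ 2 * e * (6 * R * q ^ 2) := by gcongr
            _ = 12 * e * (R * q ^ 2) := by ring
            _ ≤ k ^ 2 * (R * q ^ 2) := by gcongr
            _ = R * (k * q) ^ 2 := by ring
            _ ≤ R * (m * p) ^ 2 := by gcongr
            _ = _ := by ring
        exact le_of_mul_le_mul_left h2 (by positivity)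
      have hvol := volume_lt_abs_mul_sq_le hw hR (δ := e * p ^ 4 / (R * m ^ 2)) (l := m ^ 3)
        (by positivity) hδ hl0 (by
          rw [← hN, hp, hVR R hR, ← ENNReal.ofReal_mul (by positivity), ← ENNReal.ofReal_ofNat,
            ← ENNReal.ofReal_mul (by norm_num)]
          refine ENNReal.ofReal_le_ofReal ?_
          have : b * R ^ 3 * ((e * p ^ 4 / (R * m ^ 2)) ^ 3 * (m ^ 3) ^ 2) =
            (b * e ^ 3) * p ^ 12 := by field_simp
          rw [this]
          gcongr)
      simp only [hfd] at hvol
      refine hvol.trans (le_of_eq ?_)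
      rw [← hD, hq, ← ENNReal.ofReal_mul (by positivity)]
      congr 1
      have : (m ^ 3) ^ (-4 / 3 : ℝ) = (m ^ 4)⁻¹ := by
        rw [← Real.rpow_natCast, ← Real.rpow_mul hm0.le, ← Real.rpow_natCast,
          ← Real.rpow_neg hm0.le]
        norm_num
      rw [this]
      field_simp
  refine hcube.trans (le_of_eq ?_)
  rw [hp, hq, ENNReal.ofReal_rpow_of_pos (by positivity), ENNReal.ofReal_rpow_of_pos (by positivity),
    ← ENNReal.ofReal_mul (by positivity), ← ENNReal.ofReal_mul (by positivity)]
  congr 1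
  have h1 : (p ^ 12) ^ (3 / 4 : ℝ) = p ^ 9 := by
    rw [← Real.rpow_natCast, ← Real.rpow_mul hp0.le, ← Real.rpow_natCast]; norm_num
  have h2 : (q ^ 4) ^ (3 / 4 : ℝ) = q ^ 3 := by
    rw [← Real.rpow_natCast, ← Real.rpow_mul hq0.le, ← Real.rpow_natCast]; norm_num
  have h3 : ((k * q / p) ^ 3) ^ (-1 / 3 : ℝ) = (k * q / p)⁻¹ := by
    have h0 : 0 < k * q / p := by positivity
    rw [← Real.rpow_natCast, ← Real.rpow_mul h0.le, ← Real.rpow_neg_one]; norm_num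
  rw [h1, h2, h3]
  field_simp
  ring

/-- The multiplicative inequality at a fixed time, for `C¹` functions. -/
lemma exists_multiplicative_const_smooth : ∃ C : ℝ, 0 < C ∧ ∀ u : E3 → ℝ, ContDiff ℝ 1 u →
    ∀ r R : ℝ, 0 < r → r ≤ R →
      ∫⁻ x in ball (0 : E3) r, ‖u x‖ₑ ^ 3 ≤ ENNReal.ofReal C *
        ((∫⁻ x in ball (0 : E3) R, ‖u x‖ₑ ^ 2) ^ (3 / 4 : ℝ) *
          (∫⁻ x in ball (0 : E3) R, ‖fderiv ℝ u x‖ₑ ^ 2) ^ (3 / 4 : ℝ) +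
        ENNReal.ofReal ((r / R) ^ 3 * R ^ (-3 / 2 : ℝ)) *
          (∫⁻ x in ball (0 : E3) R, ‖u x‖ₑ ^ 2) ^ (3 / 2 : ℝ)) := by
  obtain ⟨b, hb0, hb⟩ := exists_volume_ball_eq
  obtain ⟨C, hC0, hC⟩ := exists_gagliardo_nirenberg_const
  refine ⟨4 * (C + b ^ (-1 / 2 : ℝ)), by positivity, fun u hu r R hr hrR => ?_⟩
  have hR : 0 < R := hr.trans_le hrR
  obtain ⟨a, ha1, ha2⟩ := hC u hu R hR
  set N := ∫⁻ x in ball (0 : E3) R, ‖u x‖ₑ ^ 2 with hN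
  set D := ∫⁻ x in ball (0 : E3) R, ‖fderiv ℝ u x‖ₑ ^ 2 with hD
  have hm := hu.continuous.measurable
  have hcub : ∀ x, ‖u x‖ₑ ^ 3 ≤ 4 * ‖u x - a‖ₑ ^ 3 + 4 * ‖a‖ₑ ^ 3 := by
    intro x
    have h := ENNReal.rpow_add_le_mul_rpow_add_rpow ‖u x - a‖ₑ ‖a‖ₑ (p := 3) (by norm_num)
    norm_num at h
    calc ‖u x‖ₑ ^ 3 = ‖(u x - a) + a‖ₑ ^ 3 := by simp
      _ ≤ (‖u x - a‖ₑ + ‖a‖ₑ) ^ 3 := pow_le_pow_left' (enorm_add_le _ _) 3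
      _ ≤ _ := h
      _ = _ := by ring
  have hconst : volume (ball (0 : E3) r) * ‖a‖ₑ ^ 3 ≤ ENNReal.ofReal (b ^ (-1 / 2 : ℝ)) *
      (ENNReal.ofReal ((r / R) ^ 3 * R ^ (-3 / 2 : ℝ)) * N ^ (3 / 2 : ℝ)) := by
    have h1 : (volume (ball (0 : E3) R) * ‖a‖ₑ ^ 2) ^ (3 / 2 : ℝ) ≤ N ^ (3 / 2 : ℝ) := by gcongr
    refine le_trans (le_of_eq ?_) (mul_le_mul' le_rfl (mul_le_mul' le_rfl h1))
    rw [hb r hr, hb R hR, Real.enorm_eq_ofReal_abs, ← ENNReal.ofReal_pow (abs_nonneg a),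
      ← ENNReal.ofReal_pow (abs_nonneg a), ← ENNReal.ofReal_mul (by positivity),
      ← ENNReal.ofReal_mul (by positivity), ENNReal.ofReal_rpow_of_nonneg (by positivity)
        (by norm_num), ← ENNReal.ofReal_mul (by positivity), ← ENNReal.ofReal_mul (by positivity)]
    congr 1
    have e1 : (|a| ^ 2) ^ (3 / 2 : ℝ) = |a| ^ 3 := by
      rw [← Real.rpow_natCast, ← Real.rpow_mul (abs_nonneg a), ← Real.rpow_natCast]; norm_num
    have e2 : (R ^ 3) ^ (3 / 2 : ℝ) = R ^ 3 * R ^ (3 / 2 : ℝ) := by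
      rw [← Real.rpow_natCast, ← Real.rpow_mul hR.le, ← Real.rpow_add hR]; norm_num
    have e3 : R ^ (-3 / 2 : ℝ) * R ^ (3 / 2 : ℝ) = 1 := by
      rw [← Real.rpow_add hR]; norm_num
    have e4 : b ^ (-1 / 2 : ℝ) * b ^ (3 / 2 : ℝ) = b := by
      rw [← Real.rpow_add hb0]; norm_num
    rw [Real.mul_rpow (by positivity) (by positivity), Real.mul_rpow hb0.le (by positivity), e1, e2]
    calc b * r ^ 3 * |a| ^ 3 = (b ^ (-1 / 2 : ℝ) * b ^ (3 / 2 : ℝ)) * r ^ 3 * |a| ^ 3 *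
          (R ^ (-3 / 2 : ℝ) * R ^ (3 / 2 : ℝ)) := by rw [e3, e4]; ring
      _ = _ := by field_simp
  calc _ ≤ ∫⁻ x in ball (0 : E3) r, (4 * ‖u x - a‖ₑ ^ 3 + 4 * ‖a‖ₑ ^ 3) :=
        lintegral_mono fun x => hcub x
    _ = 4 * (∫⁻ x in ball (0 : E3) r, ‖u x - a‖ₑ ^ 3) +
        4 * (volume (ball (0 : E3) r) * ‖a‖ₑ ^ 3) := by
      rw [lintegral_add_left (by fun_prop), lintegral_const_mul' _ _ (by simp), lintegral_const,
        Measure.restrict_apply_univ]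
      ring
    _ ≤ 4 * (ENNReal.ofReal C * (N ^ (3 / 4 : ℝ) * D ^ (3 / 4 : ℝ))) +
        4 * (ENNReal.ofReal (b ^ (-1 / 2 : ℝ)) *
          (ENNReal.ofReal ((r / R) ^ 3 * R ^ (-3 / 2 : ℝ)) * N ^ (3 / 2 : ℝ))) := by
      gcongr
      exact (lintegral_mono_set (ball_subset_ball hrR)).trans ha2
    _ ≤ 4 * (ENNReal.ofReal (C + b ^ (-1 / 2 : ℝ)) * (N ^ (3 / 4 : ℝ) * D ^ (3 / 4 : ℝ))) +
        4 * (ENNReal.ofReal (C + b ^ (-1 / 2 : ℝ)) *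
          (ENNReal.ofReal ((r / R) ^ 3 * R ^ (-3 / 2 : ℝ)) * N ^ (3 / 2 : ℝ))) := by
      have : 0 < b ^ (-1 / 2 : ℝ) := by positivity
      gcongr <;> linarith
    _ = _ := by
      rw [ENNReal.ofReal_mul (p := 4) (by norm_num), ENNReal.ofReal_ofNat]
      ring

lemma sq_lintegral_kernel_mul_le {α : Type*} [MeasurableSpace α] {μ : Measure α}
    {k f : α → ℝ≥0∞} (hk : AEMeasurable k μ) (hf : AEMeasurable f μ) (h1 : ∫⁻ a, k a ∂μ ≤ 1) :
    (∫⁻ a, k a * f a ∂μ) ^ 2 ≤ ∫⁻ a, k a * f a ^ 2 ∂μ := by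
  have hs : ∀ a, (k a ^ (1 / 2 : ℝ)) ^ 2 = k a := fun a => by
    rw [← ENNReal.rpow_natCast, ← ENNReal.rpow_mul]; norm_num
  have h := sq_lintegral_mul_le (μ := μ) (f := fun a => k a ^ (1 / 2 : ℝ))
    (g := fun a => k a ^ (1 / 2 : ℝ) * f a) (by fun_prop) (by fun_prop)
  simp only [← mul_assoc, ← sq, mul_pow, hs] at h
  exact h.trans (mul_le_of_le_one_left' h1)

lemma lintegral_lintegral_kernel_mul {k f : E3 → ℝ≥0∞} (hk : Measurable k)
    (hf : AEMeasurable f) (h1 : ∫⁻ x, k x = 1) :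
    ∫⁻ x, ∫⁻ y, k (x - y) * f y = ∫⁻ y, f y := by
  rw [lintegral_lintegral_swap]
  · refine lintegral_congr fun y => ?_
    rw [lintegral_mul_const _ (by fun_prop), lintegral_sub_right_eq_self k y, h1, one_mul]
  · have h2 : AEMeasurable (fun p : E3 × E3 => f p.2) (volume.prod volume) := hf.comp_snd
    have h3 : Measurable fun p : E3 × E3 => k (p.1 - p.2) := by fun_prop
    exact h3.aemeasurable.mul h2

lemma opENorm_le_of_forall_single_le {T : E3 →L[ℝ] ℝ} {K : ℝ≥0∞}
    (h : ∀ j, ‖T (EuclideanSpace.single j 1)‖ₑ ≤ K) : ‖T‖ₑ ≤ 3 * K := by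
  have h1 : ‖T‖ ≤ ∑ j, ‖T (EuclideanSpace.single j 1)‖ := by
    refine T.opNorm_le_bound (by positivity) fun x => ?_
    have hx : x = ∑ j, x j • EuclideanSpace.single j (1 : ℝ) := by
      ext i
      simp [Finset.sum_apply, Pi.single_apply]
    calc ‖T x‖ = ‖∑ j, x j • T (EuclideanSpace.single j 1)‖ := by
          conv_lhs => rw [hx]
          simp
      _ ≤ ∑ j, ‖x j • T (EuclideanSpace.single j 1)‖ := norm_sum_le _ _
      _ ≤ ∑ j, ‖T (EuclideanSpace.single j 1)‖ * ‖x‖ := by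
          gcongr with j
          rw [norm_smul, mul_comm]
          gcongr
          exact PiLp.norm_apply_le x j
      _ = _ := by rw [Finset.sum_mul]
  calc ‖T‖ₑ ≤ ENNReal.ofReal (∑ j, ‖T (EuclideanSpace.single j 1)‖) := by
        rw [← ofReal_norm]; exact ENNReal.ofReal_le_ofReal h1
    _ = ∑ j, ‖T (EuclideanSpace.single j 1)‖ₑ := by
        rw [ENNReal.ofReal_sum_of_nonneg fun _ _ => norm_nonneg _]
        simp only [ofReal_norm]
    _ ≤ ∑ _j : Fin 3, K := Finset.sum_le_sum fun j _ => h j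
    _ = _ := by simp

open ContinuousLinearMap Convolution

lemma ContDiffBump.lintegral_enorm_normed (φ : ContDiffBump (0 : E3)) :
    ∫⁻ x, ‖φ.normed volume x‖ₑ = 1 := by
  rw [← ofReal_integral_norm_eq_lintegral_enorm φ.integrable_normed]
  simp only [Real.norm_of_nonneg (φ.nonneg_normed _), φ.integral_normed, ENNReal.ofReal_one]

lemma ContDiffBump.lintegral_enorm_normed_sub (φ : ContDiffBump (0 : E3)) (x : E3) :
    ∫⁻ y, ‖φ.normed volume (x - y)‖ₑ = 1 := by
  rw [lintegral_sub_left_eq_self (fun y => ‖φ.normed volume y‖ₑ) x, φ.lintegral_enorm_normed]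

lemma ContDiffBump.lintegral_enorm_convolution_sq_le (φ : ContDiffBump (0 : E3)) {f : E3 → ℝ}
    (hf : AEStronglyMeasurable f) :
    ∫⁻ x, ‖(φ.normed volume ⋆[lsmul ℝ ℝ, volume] f) x‖ₑ ^ 2 ≤ ∫⁻ x, ‖f x‖ₑ ^ 2 := by
  have hk : Measurable fun x => ‖φ.normed volume x‖ₑ :=
    (φ.continuous_normed (μ := volume)).measurable.enorm
  rw [← lintegral_lintegral_kernel_mul hk (hf.enorm.pow_const 2) φ.lintegral_enorm_normed]
  refine lintegral_mono fun x => ?_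
  refine le_trans ?_ (sq_lintegral_kernel_mul_le
    (hk.comp (measurable_const.sub measurable_id)).aemeasurable hf.enorm
    (φ.lintegral_enorm_normed_sub x).le)
  rw [convolution_eq_swap]
  gcongr
  refine (enorm_integral_le_lintegral_enorm _).trans (lintegral_mono fun y => ?_)
  simp [enorm_mul]

/-- On the part of `s` at distance more than `φ.rOut` from its complement, the gradient of a
mollification is controlled by the mollification of the weak gradient on `s`. -/
lemma ContDiffBump.lintegral_enorm_fderiv_convolution_sq_le (φ : ContDiffBump (0 : E3))
    {s U : Set E3} (hs : MeasurableSet s) (hU : ∀ x ∈ U, closedBall x φ.rOut ⊆ s)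
    (hUm : MeasurableSet U)
    {u : E3 → ℝ} (hu : IntegrableOn u s) {h : E3 → ℝ≥0∞} (hh : AEMeasurable h (volume.restrict s))
    {g : Fin 3 → E3 → ℝ} (hg : ∀ j x, ‖g j x‖ₑ ≤ h x)
    (hw : ∀ ψ : E3 → ℝ, ContDiff ℝ (⊤ : ℕ∞) ψ → tsupport ψ ⊆ s → ∀ j,
      ∫ x in s, u x * fderiv ℝ ψ x (EuclideanSpace.single j (1 : ℝ)) = - ∫ x in s, g j x * ψ x) :
    ∫⁻ x in U, ‖fderiv ℝ (φ.normed volume ⋆[lsmul ℝ ℝ, volume] s.indicator u) x‖ₑ ^ 2 ≤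
      9 * ∫⁻ x in s, h x ^ 2 := by
  have hk : Measurable fun x => ‖φ.normed volume x‖ₑ :=
    (φ.continuous_normed (μ := volume)).measurable.enorm
  have hφ : ContDiff ℝ (⊤ : ℕ∞) (φ.normed volume) := φ.contDiff_normed
  have hui : LocallyIntegrable (s.indicator u) := (hu.integrable_indicator hs).locallyIntegrable
  have hpt : ∀ x ∈ U, ‖fderiv ℝ (φ.normed volume ⋆[lsmul ℝ ℝ, volume] s.indicator u) x‖ₑ ^ 2 ≤
      9 * ∫⁻ y, ‖φ.normed volume (x - y)‖ₑ * (s.indicator (fun y => h y ^ 2) y) := by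
    intro x hx
    have hd := φ.hasCompactSupport_normed.hasFDerivAt_convolution_left (lsmul ℝ ℝ)
      (hφ.of_le (by exact_mod_cast le_top)) hui x
    have hψ : ContDiff ℝ (⊤ : ℕ∞) fun y => φ.normed volume (x - y) :=
      hφ.comp (contDiff_const.sub contDiff_id)
    have hψs : tsupport (fun y => φ.normed volume (x - y)) ⊆ s := by
      refine subset_trans (closure_minimal (fun y hy => ?_) isClosed_closedBall) (hU x hx)
      have : x - y ∈ Function.support (φ.normed volume) := hy
      rw [φ.support_normed_eq, mem_ball_zero_iff] at this
      rw [mem_closedBall', dist_eq_norm]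
      exact this.le
    have hj : ∀ j, ‖fderiv ℝ (φ.normed volume ⋆[lsmul ℝ ℝ, volume] s.indicator u) x
        (EuclideanSpace.single j 1)‖ₑ ≤ ∫⁻ y in s, ‖φ.normed volume (x - y)‖ₑ * h y := by
      intro j
      have e1 : fderiv ℝ (φ.normed volume ⋆[lsmul ℝ ℝ, volume] s.indicator u) x
          (EuclideanSpace.single j 1) =
          ∫ y in s, g j y * φ.normed volume (x - y) := by
        rw [hd.fderiv, ← neg_eq_iff_eq_neg.mpr (hw _ hψ hψs j), convolution_eq_swap,
          ← integral_neg, integral_apply, ← integral_indicator hs]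
        · refine integral_congr_ae (.of_forall fun y => ?_)
          have : fderiv ℝ (fun y => φ.normed volume (x - y)) y =
              -fderiv ℝ (φ.normed volume) (x - y) := by
            have h1 := (hφ.differentiable (by simp) (x - y)).hasFDerivAt
            have h2 := h1.comp y ((hasFDerivAt_id y).const_sub x)
            simpa [Function.comp_def] using h2.fderiv
          by_cases hy : y ∈ s <;>
            simp [hy, this, mul_comm]
        · exact ((φ.hasCompactSupport_normed.fderiv (𝕜 := ℝ)).convolutionExists_left _
            (hφ.continuous_fderiv (by simp)) hui x).integrable_swap
      rw [e1]
      refine (enorm_integral_le_lintegral_enorm _).trans (lintegral_mono fun y => ?_)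
      rw [enorm_mul, mul_comm]
      gcongr
      exact hg j y
    have h1 := pow_le_pow_left' (opENorm_le_of_forall_single_le hj) 2
    refine h1.trans ?_
    rw [mul_pow]
    norm_num
    gcongr
    refine (sq_lintegral_kernel_mul_le
      (hk.comp (measurable_const.sub measurable_id)).aemeasurable hh ?_).trans ?_
    · exact (setLIntegral_le_lintegral _ _).trans (φ.lintegral_enorm_normed_sub x).le
    · rw [← lintegral_indicator hs]
      refine lintegral_mono fun y => ?_
      by_cases hy : y ∈ s <;> simp [hy]
  calc _ ≤ ∫⁻ x in U, 9 * ∫⁻ y, ‖φ.normed volume (x - y)‖ₑ *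
        (s.indicator (fun y => h y ^ 2) y) := setLIntegral_mono' hUm hpt
    _ ≤ ∫⁻ x, 9 * ∫⁻ y, ‖φ.normed volume (x - y)‖ₑ *
        (s.indicator (fun y => h y ^ 2) y) := setLIntegral_le_lintegral _ _
    _ = _ := by
      rw [lintegral_const_mul' _ _ (by simp), lintegral_lintegral_kernel_mul hk
        ((aemeasurable_indicator_iff hs).2 (hh.pow_const 2)) φ.lintegral_enorm_normed,
        lintegral_indicator hs]

/-- The multiplicative inequality at a fixed time, for scalar functions with a square integrable
bound `h` on their weak gradient. -/
lemma exists_multiplicative_const_slice : ∃ C : ℝ, 0 < C ∧ ∀ (u : E3 → ℝ) (r ϱ : ℝ), 0 < r →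
    r ≤ ϱ → AEStronglyMeasurable u (volume.restrict (ball 0 ϱ)) →
    ∫⁻ x in ball (0 : E3) ϱ, ‖u x‖ₑ ^ 2 ≠ ∞ →
    ∀ h : E3 → ℝ≥0∞, AEMeasurable h (volume.restrict (ball 0 ϱ)) →
    ∀ g : Fin 3 → E3 → ℝ, (∀ j x, ‖g j x‖ₑ ≤ h x) →
    (∀ ψ : E3 → ℝ, ContDiff ℝ (⊤ : ℕ∞) ψ → tsupport ψ ⊆ ball 0 ϱ → ∀ j,
      ∫ x in ball 0 ϱ, u x * fderiv ℝ ψ x (EuclideanSpace.single j (1 : ℝ)) =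
        - ∫ x in ball 0 ϱ, g j x * ψ x) →
    ∫⁻ x in ball (0 : E3) r, ‖u x‖ₑ ^ 3 ≤ ENNReal.ofReal C *
      ((∫⁻ x in ball (0 : E3) ϱ, ‖u x‖ₑ ^ 2) ^ (3 / 4 : ℝ) *
        (∫⁻ x in ball (0 : E3) ϱ, h x ^ 2) ^ (3 / 4 : ℝ) +
      ENNReal.ofReal ((r / ϱ) ^ 3 * ϱ ^ (-3 / 2 : ℝ)) *
        (∫⁻ x in ball (0 : E3) ϱ, ‖u x‖ₑ ^ 2) ^ (3 / 2 : ℝ)) := by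
  obtain ⟨C, hC0, hC⟩ := exists_multiplicative_const_smooth
  refine ⟨9 * C, by positivity, fun u r ϱ hr hrϱ hu hN h hh g hg hw => ?_⟩
  have hϱ : 0 < ϱ := hr.trans_le hrϱ
  have hui : IntegrableOn u (ball 0 ϱ) := by
    refine ⟨hu, (lintegral_mono fun x => ?_).trans_lt
      (b := ∫⁻ x in ball (0 : E3) ϱ, (1 + ‖u x‖ₑ ^ 2)) ?_⟩
    · rcases le_total ‖u x‖ₑ 1 with h1 | h1
      · exact h1.trans le_self_add
      · exact (le_self_pow₀ h1 two_ne_zero).trans le_add_self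
    · rw [lintegral_add_left (by fun_prop), lintegral_const, one_mul,
        Measure.restrict_apply_univ]
      exact ENNReal.add_lt_top.2 ⟨measure_ball_lt_top, hN.lt_top⟩
  set f := (ball (0 : E3) ϱ).indicator u with hf
  have hfi : Integrable f := hui.integrable_indicator measurableSet_ball
  have hfN : ∫⁻ x, ‖f x‖ₑ ^ 2 = ∫⁻ x in ball (0 : E3) ϱ, ‖u x‖ₑ ^ 2 := by
    rw [← lintegral_indicator measurableSet_ball]
    refine lintegral_congr fun x => ?_
    by_cases hx : x ∈ ball (0 : E3) ϱ <;> simp only [hf, hx, indicator_of_mem,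
      indicator_of_notMem, not_false_eq_true, enorm_zero, ne_eq, two_ne_zero, zero_pow]
  set N := ∫⁻ x in ball (0 : E3) ϱ, ‖u x‖ₑ ^ 2
  set H := ∫⁻ x in ball (0 : E3) ϱ, h x ^ 2
  let l : ℕ → ℝ := fun k => 1 / ((k : ℝ) + 2)
  have hl0 : ∀ k, 0 < l k := fun k => by positivity
  have hl1 : ∀ k, l k ≤ 1 / 2 := fun k =>
    one_div_le_one_div_of_le two_pos (by linarith [(k.cast_nonneg : (0 : ℝ) ≤ k)])
  have hlt : Filter.Tendsto l Filter.atTop (nhds 0) :=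
    tendsto_const_nhds.div_atTop
      (Filter.tendsto_atTop_add_const_right _ _ tendsto_natCast_atTop_atTop)
  let φ : ℕ → ContDiffBump (0 : E3) := fun k =>
    ⟨ϱ * l k / 2, ϱ * l k, half_pos (mul_pos hϱ (hl0 k)), half_lt_self (mul_pos hϱ (hl0 k))⟩
  let w : ℕ → E3 → ℝ := fun k => (φ k).normed volume ⋆[lsmul ℝ ℝ, volume] f
  have hw1 : ∀ k, ContDiff ℝ 1 (w k) := fun k =>
    (φ k).hasCompactSupport_normed.contDiff_convolution_left (lsmul ℝ ℝ) (n := 1)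
      (φ k).contDiff_normed hfi.locallyIntegrable
  have hlim : ∀ᵐ x, Filter.Tendsto (fun k => w k x) Filter.atTop (nhds (f x)) := by
    refine ContDiffBump.ae_convolution_tendsto_right_of_locallyIntegrable (K := 2) ?_ ?_
      hfi.locallyIntegrable
    · simpa using hlt.const_mul ϱ
    · exact .of_forall fun k => by simp only [φ]; linarith
  have hbound : ∀ k, ∫⁻ x in ball (0 : E3) (r * (1 - l k)), ‖w k x‖ₑ ^ 3 ≤
      ENNReal.ofReal (9 * C) * (N ^ (3 / 4 : ℝ) * H ^ (3 / 4 : ℝ) +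
        ENNReal.ofReal ((r / ϱ) ^ 3 * ϱ ^ (-3 / 2 : ℝ)) * N ^ (3 / 2 : ℝ)) := by
    intro k
    have h1 : 0 < 1 - l k := by linarith [hl1 k]
    have hwN : ∫⁻ x in ball (0 : E3) (ϱ * (1 - l k)), ‖w k x‖ₑ ^ 2 ≤ N :=
      (setLIntegral_le_lintegral _ _).trans
        (((φ k).lintegral_enorm_convolution_sq_le hfi.aestronglyMeasurable).trans hfN.le)
    have hwD : ∫⁻ x in ball (0 : E3) (ϱ * (1 - l k)), ‖fderiv ℝ (w k) x‖ₑ ^ 2 ≤ 9 * H := by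
      refine (φ k).lintegral_enorm_fderiv_convolution_sq_le measurableSet_ball (fun x hx => ?_)
        measurableSet_ball hui hh hg hw
      refine closedBall_subset_ball' ?_
      rw [mem_ball] at hx
      simp only [φ]
      linarith
    have h9 : (9 : ℝ≥0∞) ^ (3 / 4 : ℝ) ≤ 9 :=
      (ENNReal.rpow_le_rpow_of_exponent_le (by norm_num) (by norm_num)).trans_eq
        (ENNReal.rpow_one 9)
    have hcoef : (r * (1 - l k) / (ϱ * (1 - l k))) ^ 3 * (ϱ * (1 - l k)) ^ (-3 / 2 : ℝ) ≤
        9 * ((r / ϱ) ^ 3 * ϱ ^ (-3 / 2 : ℝ)) := by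
      rw [mul_div_mul_right _ _ h1.ne', Real.mul_rpow hϱ.le h1.le]
      have h2 : (1 - l k) ^ (-3 / 2 : ℝ) ≤ 9 := by
        calc (1 - l k) ^ (-3 / 2 : ℝ) ≤ (1 / 2 : ℝ) ^ (-3 / 2 : ℝ) :=
              Real.rpow_le_rpow_of_nonpos (by norm_num) (by linarith [hl1 k]) (by norm_num)
          _ ≤ (1 / 2 : ℝ) ^ (-3 : ℝ) :=
              Real.rpow_le_rpow_of_exponent_ge (by norm_num) (by norm_num) (by norm_num)
          _ ≤ 9 := by rw [Real.rpow_neg (by norm_num)]; norm_num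
      have h3 : 0 ≤ (r / ϱ) ^ 3 * ϱ ^ (-3 / 2 : ℝ) := by positivity
      nlinarith
    refine (hC (w k) (hw1 k) _ _ (mul_pos hr h1)
      (mul_le_mul_of_nonneg_right hrϱ h1.le)).trans ?_
    calc _ ≤ ENNReal.ofReal C * (N ^ (3 / 4 : ℝ) * (9 * H) ^ (3 / 4 : ℝ) +
          ENNReal.ofReal (9 * ((r / ϱ) ^ 3 * ϱ ^ (-3 / 2 : ℝ))) * N ^ (3 / 2 : ℝ)) := by
          gcongr
      _ ≤ ENNReal.ofReal C * (N ^ (3 / 4 : ℝ) * (9 * H ^ (3 / 4 : ℝ)) +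
          9 * ENNReal.ofReal ((r / ϱ) ^ 3 * ϱ ^ (-3 / 2 : ℝ)) * N ^ (3 / 2 : ℝ)) := by
          rw [ENNReal.mul_rpow_of_nonneg _ _ (by norm_num),
            ENNReal.ofReal_mul (p := 9) (by norm_num), ENNReal.ofReal_ofNat]
          gcongr
      _ = _ := by
          rw [ENNReal.ofReal_mul (p := 9) (by norm_num), ENNReal.ofReal_ofNat]
          ring
  let F : ℕ → E3 → ℝ≥0∞ := fun k =>
    (ball (0 : E3) (r * (1 - l k))).indicator fun x => ‖w k x‖ₑ ^ 3
  have hF : ∀ᵐ x ∂volume.restrict (ball (0 : E3) r),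
      ‖u x‖ₑ ^ 3 = Filter.liminf (fun k => F k x) Filter.atTop := by
    filter_upwards [ae_restrict_of_ae hlim, ae_restrict_mem measurableSet_ball] with x hx hxr
    refine (Filter.Tendsto.liminf_eq ?_).symm
    have hfx : f x = u x := indicator_of_mem (ball_subset_ball hrϱ hxr) u
    rw [hfx] at hx
    refine ((ENNReal.continuous_pow 3).continuousAt.tendsto.comp hx.enorm).congr' ?_
    have h2 : Filter.Tendsto (fun k => r * (1 - l k)) Filter.atTop (nhds r) := by
      simpa using (hlt.const_sub 1).const_mul r
    filter_upwards [h2.eventually_const_lt (mem_ball_zero_iff.1 hxr)] with k hk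
    simp [F, indicator_of_mem, hk]
  calc _ = ∫⁻ x in ball (0 : E3) r, Filter.liminf (fun k => F k x) Filter.atTop :=
        lintegral_congr_ae hF
    _ ≤ Filter.liminf (fun k => ∫⁻ x in ball (0 : E3) r, F k x) Filter.atTop :=
        lintegral_liminf_le fun k =>
          (((hw1 k).continuous.measurable.enorm).pow_const 3).indicator measurableSet_ball
    _ ≤ _ := by
      refine Filter.liminf_le_of_frequently_le' (.of_forall fun k => ?_)
      refine (setLIntegral_le_lintegral _ _).trans ?_
      rw [lintegral_indicator measurableSet_ball]
      exact hbound k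

lemma enorm_cube_le_sum (a : E3) : ‖a‖ₑ ^ 3 ≤ 9 * ∑ i, ‖a i‖ₑ ^ 3 := by
  have h1 : ‖a‖ ≤ ∑ i, ‖a i‖ := by
    rw [EuclideanSpace.norm_eq, Real.sqrt_le_left (by positivity)]
    simp only [Fin.sum_univ_three]
    nlinarith [mul_nonneg (norm_nonneg (a 0)) (norm_nonneg (a 1)),
      mul_nonneg (norm_nonneg (a 0)) (norm_nonneg (a 2)),
      mul_nonneg (norm_nonneg (a 1)) (norm_nonneg (a 2))]
  have h2 := pow_sum_div_card_le_sum_pow (s := Finset.univ) (f := fun i => ‖a i‖)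
    (fun i _ => norm_nonneg _) 2
  have h3 : ‖a‖ ^ 3 ≤ 9 * ∑ i, ‖a i‖ ^ 3 := by
    have := pow_le_pow_left₀ (norm_nonneg a) h1 3
    norm_num [-Real.norm_eq_abs] at h2
    linarith
  have h4 := ENNReal.ofReal_le_ofReal h3
  rw [ENNReal.ofReal_mul (by norm_num), ENNReal.ofReal_sum_of_nonneg (by intros; positivity)] at h4
  simpa [ENNReal.ofReal_pow, -Real.norm_eq_abs] using h4

/-- The multiplicative inequality at a fixed time, for vector fields. -/
lemma exists_multiplicative_const_slice_vector : ∃ C : ℝ, 0 < C ∧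
    ∀ (w : E3 → E3) (G : E3 → Fin 3 → Fin 3 → ℝ) (r ϱ : ℝ), 0 < r → r ≤ ϱ →
    AEStronglyMeasurable w (volume.restrict (ball 0 ϱ)) →
    IntegrableOn (fun x => ‖w x‖ ^ 2) (ball 0 ϱ) →
    IntegrableOn (fun x => ∑ i, ∑ j, G x i j ^ 2) (ball 0 ϱ) →
    (∀ ψ : E3 → ℝ, ContDiff ℝ (⊤ : ℕ∞) ψ → tsupport ψ ⊆ ball 0 ϱ → ∀ i j,
      ∫ x in ball 0 ϱ, w x i * fderiv ℝ ψ x (EuclideanSpace.single j (1 : ℝ)) =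
        - ∫ x in ball 0 ϱ, G x i j * ψ x) →
    ∫ x in ball (0 : E3) r, ‖w x‖ ^ 3 ≤ C *
      ((∫ x in ball (0 : E3) ϱ, ‖w x‖ ^ 2) ^ (3 / 4 : ℝ) *
        (∫ x in ball (0 : E3) ϱ, ∑ i, ∑ j, G x i j ^ 2) ^ (3 / 4 : ℝ) +
      (r / ϱ) ^ 3 * ϱ ^ (-3 / 2 : ℝ) *
        (∫ x in ball (0 : E3) ϱ, ‖w x‖ ^ 2) ^ (3 / 2 : ℝ)) := by
  obtain ⟨C, hC0, hC⟩ := exists_multiplicative_const_slice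
  refine ⟨27 * C, by positivity, fun w G r ϱ hr hrϱ hw hw2 hG hwG => ?_⟩
  have hϱ : 0 < ϱ := hr.trans_le hrϱ
  set N := ∫ x in ball (0 : E3) ϱ, ‖w x‖ ^ 2
  set D := ∫ x in ball (0 : E3) ϱ, ∑ i, ∑ j, G x i j ^ 2
  have hN0 : 0 ≤ N := integral_nonneg fun x => by positivity
  have hD0 : 0 ≤ D := integral_nonneg fun x => by positivity
  have hN : ∫⁻ x in ball (0 : E3) ϱ, ‖w x‖ₑ ^ 2 = ENNReal.ofReal N := by
    rw [ofReal_integral_eq_lintegral_ofReal hw2 (.of_forall fun x => by positivity)]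
    simp [ENNReal.ofReal_pow]
  have hNi : ∀ i, ∫⁻ x in ball (0 : E3) ϱ, ‖w x i‖ₑ ^ 2 ≤ ENNReal.ofReal N := by
    intro i
    rw [← hN]
    gcongr with x
    exact enorm_le_iff_norm_le.2 (PiLp.norm_apply_le _ _)
  let h : E3 → ℝ≥0∞ := fun x => ENNReal.ofReal √(∑ i, ∑ j, G x i j ^ 2)
  have hh : AEMeasurable h (volume.restrict (ball 0 ϱ)) :=
    (Real.continuous_sqrt.measurable.comp_aemeasurable hG.aemeasurable).ennreal_ofReal
  have hD : ∫⁻ x in ball (0 : E3) ϱ, h x ^ 2 = ENNReal.ofReal D := by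
    rw [ofReal_integral_eq_lintegral_ofReal hG (.of_forall fun x => by positivity)]
    refine lintegral_congr fun x => ?_
    rw [← ENNReal.ofReal_pow (Real.sqrt_nonneg _), Real.sq_sqrt (by positivity)]
  have hGh : ∀ i j x, ‖G x i j‖ₑ ≤ h x := by
    intro i j x
    rw [Real.enorm_eq_ofReal_abs]
    refine ENNReal.ofReal_le_ofReal (Real.abs_le_sqrt ?_)
    exact (Finset.single_le_sum (f := fun j => G x i j ^ 2) (fun j _ => sq_nonneg _)
      (Finset.mem_univ j)).trans
      (Finset.single_le_sum (f := fun i => ∑ j, G x i j ^ 2) (fun i _ => by positivity)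
        (Finset.mem_univ i))
  have hwi : ∀ i, AEStronglyMeasurable (fun x => w x i) (volume.restrict (ball 0 ϱ)) :=
    fun i => (PiLp.continuous_apply 2 _ i).comp_aestronglyMeasurable hw
  have key : ∀ i, ∫⁻ x in ball (0 : E3) r, ‖w x i‖ₑ ^ 3 ≤ ENNReal.ofReal (C *
      (N ^ (3 / 4 : ℝ) * D ^ (3 / 4 : ℝ) + (r / ϱ) ^ 3 * ϱ ^ (-3 / 2 : ℝ) * N ^ (3 / 2 : ℝ))) := by
    intro i
    refine (hC (fun x => w x i) r ϱ hr hrϱ (hwi i)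
      ((hNi i).trans_lt ENNReal.ofReal_lt_top).ne h hh (fun j x => G x i j) (fun j x => hGh i j x)
      fun ψ hψ hψs j => hwG ψ hψ hψs i j).trans ?_
    rw [hD, ENNReal.ofReal_mul hC0.le, ENNReal.ofReal_add (by positivity) (by positivity),
      ENNReal.ofReal_mul (p := N ^ (3 / 4 : ℝ)) (by positivity),
      ENNReal.ofReal_mul (q := N ^ (3 / 2 : ℝ)) (by positivity),
      ← ENNReal.ofReal_rpow_of_nonneg hN0 (by norm_num),
      ← ENNReal.ofReal_rpow_of_nonneg hN0 (by norm_num),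
      ← ENNReal.ofReal_rpow_of_nonneg hD0 (by norm_num)]
    have := hNi i
    gcongr
  have hw' := hw.mono_measure (Measure.restrict_mono_set volume (ball_subset_ball hrϱ))
  rw [integral_eq_lintegral_of_nonneg_ae (.of_forall fun x => by positivity)
    (by fun_prop)]
  refine ENNReal.toReal_le_of_le_ofReal (by positivity) ?_
  calc _ = ∫⁻ x in ball (0 : E3) r, ‖w x‖ₑ ^ 3 := by simp [ENNReal.ofReal_pow]
    _ ≤ ∫⁻ x in ball (0 : E3) r, 9 * ∑ i, ‖w x i‖ₑ ^ 3 :=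
      lintegral_mono fun x => enorm_cube_le_sum _
    _ = 9 * ∑ i, ∫⁻ x in ball (0 : E3) r, ‖w x i‖ₑ ^ 3 := by
      rw [lintegral_const_mul' _ _ (by simp), lintegral_finsetSum' _ fun i _ =>
        ((hwi i).mono_measure
          (Measure.restrict_mono_set volume (ball_subset_ball hrϱ))).enorm.pow_const 3]
    _ ≤ 9 * ∑ _i : Fin 3, ENNReal.ofReal (C * (N ^ (3 / 4 : ℝ) * D ^ (3 / 4 : ℝ) +
        (r / ϱ) ^ 3 * ϱ ^ (-3 / 2 : ℝ) * N ^ (3 / 2 : ℝ))) := by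
      gcongr with i
      exact key i
    _ = _ := by
      rw [mul_assoc 27 C, ENNReal.ofReal_mul (p := 27) (by norm_num), ENNReal.ofReal_ofNat]
      simp only [Finset.sum_const, Finset.card_univ, Fintype.card_fin, nsmul_eq_mul, ← mul_assoc]
      norm_num

lemma integrable_rpow_of_le_one {α : Type*} [MeasurableSpace α] {μ : Measure α}
    [IsFiniteMeasure μ] {f : α → ℝ} (hf : Integrable f μ) (hf0 : ∀ a, 0 ≤ f a) {p : ℝ}
    (hp0 : 0 ≤ p) (hp1 : p ≤ 1) : Integrable (fun a => f a ^ p) μ := by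
  refine ((integrable_const 1).add hf).mono'
    (hf.aemeasurable.pow_const p).aestronglyMeasurable (.of_forall fun a => ?_)
  rw [Real.norm_of_nonneg (Real.rpow_nonneg (hf0 a) p)]
  rcases le_total (f a) 1 with h | h
  · exact (Real.rpow_le_one (hf0 a) h hp0).trans (le_add_of_nonneg_right (hf0 a))
  · exact (Real.rpow_le_rpow_of_exponent_le h hp1).trans
      (by rw [Real.rpow_one]; exact le_add_of_nonneg_left zero_le_one)

/-- Hölder's inequality against the constant function `1`. -/
lemma integral_rpow_three_quarters_le {α : Type*} [MeasurableSpace α] {μ : Measure α}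
    [IsFiniteMeasure μ] {f : α → ℝ} (hf : Integrable f μ) (hf0 : ∀ a, 0 ≤ f a) :
    ∫ a, f a ^ (3 / 4 : ℝ) ∂μ ≤ μ.real univ ^ (1 / 4 : ℝ) * (∫ a, f a ∂μ) ^ (3 / 4 : ℝ) := by
  have h := ENNReal.lintegral_mul_le_Lp_mul_Lq μ (p := 4 / 3) (q := 4)
    (by constructor <;> norm_num) (f := fun a => ENNReal.ofReal (f a) ^ (3 / 4 : ℝ))
    (g := fun _ => 1) (hf.aemeasurable.ennreal_ofReal.pow_const _) aemeasurable_const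
  simp only [Pi.mul_apply, mul_one, ← ENNReal.rpow_mul, ENNReal.one_rpow, lintegral_one] at h
  norm_num at h
  rw [integral_eq_lintegral_of_nonneg_ae (.of_forall fun a => Real.rpow_nonneg (hf0 a) _)
    (hf.aemeasurable.pow_const _).aestronglyMeasurable]
  have hi : 0 ≤ ∫ a, f a ∂μ := integral_nonneg hf0
  refine ENNReal.toReal_le_of_le_ofReal (by positivity) ?_
  simp only [← ENNReal.ofReal_rpow_of_nonneg (hf0 _) (by norm_num : (0 : ℝ) ≤ 3 / 4)]
  refine h.trans_eq ?_
  rw [mul_comm, ENNReal.ofReal_mul (by positivity),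
    ← ENNReal.ofReal_rpow_of_nonneg measureReal_nonneg (by norm_num),
    ← ENNReal.ofReal_rpow_of_nonneg hi (by norm_num), ofReal_measureReal,
    ofReal_integral_eq_lintegral_ofReal hf (.of_forall hf0)]

lemma timeI_subset {r ϱ : ℝ} (hr : 0 ≤ r) (h : r ≤ ϱ) : timeI r ⊆ timeI ϱ :=
  Ioo_subset_Ioo_left (by gcongr)

lemma volume_restrict_QSet (ϱ : ℝ) : (volume : Measure (E3 × ℝ)).restrict (QSet ϱ) =
    (volume.restrict (ballB ϱ)).prod (volume.restrict (timeI ϱ)) := by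
  rw [Measure.prod_restrict]
  rfl

lemma VelocityClass.ae_slice {v : E3 → ℝ → E3} {gv : E3 → ℝ → Fin 3 → Fin 3 → ℝ} {ϱ : ℝ}
    (hv : VelocityClass v gv ϱ) : ∀ᵐ t ∂volume.restrict (timeI ϱ),
      AEStronglyMeasurable (fun x => v x t) (volume.restrict (ballB ϱ)) ∧
      IntegrableOn (fun x => ‖v x t‖ ^ 2) (ballB ϱ) ∧
      IntegrableOn (fun x => ∑ i, ∑ j, gv x t i j ^ 2) (ballB ϱ) ∧
      ∀ φ : E3 → ℝ, ContDiff ℝ (⊤ : ℕ∞) φ → tsupport φ ⊆ ballB ϱ →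
        ∀ i j, ∫ x in ballB ϱ, v x t i * fderiv ℝ φ x (EuclideanSpace.single j (1 : ℝ))
          = - ∫ x in ballB ϱ, gv x t i j * φ x := by
  have h1 := hv.v_meas.aestronglyMeasurable
  have h2 := hv.v_L2
  have h3 := hv.grad_L2
  rw [IntegrableOn, volume_restrict_QSet] at h2 h3
  rw [volume_restrict_QSet] at h1
  filter_upwards [h1.prodMk_right, h2.prod_left_ae, h3.prod_left_ae, hv.isGrad]
    with t ht1 ht2 ht3 ht4 using ⟨ht1, ht2, ht3, ht4⟩

lemma VelocityClass.ae_integral_norm_sq_le {v : E3 → ℝ → E3}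
    {gv : E3 → ℝ → Fin 3 → Fin 3 → ℝ} {R ϱ : ℝ} (hv : VelocityClass v gv R) (hϱ : 0 < ϱ)
    (hR : ϱ ≤ R) :
    ∀ᵐ t ∂volume.restrict (timeI ϱ), ∫ x in ballB ϱ, ‖v x t‖ ^ 2 ≤ ϱ * funA v ϱ := by
  obtain ⟨M, hM⟩ := hv.v_Linfty
  have hbdd : Filter.IsBoundedUnder (· ≤ ·) (ae (volume.restrict (timeI ϱ)))
      fun t => (1 / ϱ) * ∫ x in ballB ϱ, ‖v x t‖ ^ 2 := by
    refine Filter.isBoundedUnder_of_eventually_le (a := (1 / ϱ) * M) ?_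
    filter_upwards [ae_restrict_of_ae_restrict_of_subset (timeI_subset hϱ.le hR)
      (hM.and hv.ae_slice)] with t ⟨h1, _, h2, _⟩
    gcongr
    refine le_trans ?_ h1
    exact setIntegral_mono_set h2 (.of_forall fun x => by positivity)
      (.of_forall (ball_subset_ball hR))
  filter_upwards [ae_le_essSup hbdd] with t ht
  rw [← div_le_iff₀' hϱ, div_eq_inv_mul, ← one_div]
  exact ht

/-- Multiplicative inequality (2.1): there is a universal `c > 0` such that for every
`v ∈ L_∞(-1,0;L₂(B)) ∩ L₂(-1,0;W¹₂(B))` and all `0 < r ≤ ϱ ≤ 1`,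
`C(r) ≤ c [(ϱ/r)³ A^{3/4}(ϱ) E^{3/4}(ϱ) + (r/ϱ)³ A^{3/2}(ϱ)]`. -/
theorem multiplicative_inequality :
    ∃ c : ℝ, 0 < c ∧
      ∀ (v : E3 → ℝ → E3) (gv : E3 → ℝ → Fin 3 → Fin 3 → ℝ),
        VelocityClass v gv 1 →
        ∀ r ϱ : ℝ, 0 < r → r ≤ ϱ → ϱ ≤ 1 →
          funC v r
            ≤ c * ((ϱ / r) ^ 3 * funA v ϱ ^ ((3 : ℝ) / 4) * funE gv ϱ ^ ((3 : ℝ) / 4)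
                + (r / ϱ) ^ 3 * funA v ϱ ^ ((3 : ℝ) / 2)) := by
  obtain ⟨C, hC0, hC⟩ := exists_multiplicative_const_slice_vector
  refine ⟨C, hC0, fun v gv hv r ϱ hr hrϱ hϱ1 => ?_⟩
  have hϱ : 0 < ϱ := hr.trans_le hrϱ
  have hI : timeI r ⊆ timeI ϱ := timeI_subset hr.le hrϱ
  have hI1 : timeI ϱ ⊆ timeI 1 := timeI_subset hϱ.le hϱ1
  have hB1 : ballB ϱ ⊆ ballB 1 := ball_subset_ball hϱ1
  set N : ℝ → ℝ := fun t => ∫ x in ballB ϱ, ‖v x t‖ ^ 2 with hNdef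
  set D : ℝ → ℝ := fun t => ∫ x in ballB ϱ, ∑ i, ∑ j, gv x t i j ^ 2 with hDdef
  have hN0 : ∀ t, 0 ≤ N t := fun t => integral_nonneg fun x => by positivity
  have hD0 : ∀ t, 0 ≤ D t := fun t => integral_nonneg fun x => by positivity
  have hDi : IntegrableOn D (timeI ϱ) := by
    have hint := hv.grad_L2.mono_set (prod_mono hB1 hI1)
    rw [← QSet, IntegrableOn, volume_restrict_QSet] at hint
    exact hint.integral_prod_right
  have hA : ∀ᵐ t ∂volume.restrict (timeI ϱ), N t ≤ ϱ * funA v ϱ :=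
    hv.ae_integral_norm_sq_le hϱ hϱ1
  have hA0 : 0 ≤ funA v ϱ := by
    have : (ae (volume.restrict (timeI ϱ))).NeBot := by
      rw [ae_neBot, Ne, Measure.restrict_eq_zero, timeI, Real.volume_Ioo]
      simp [hϱ.ne']
    obtain ⟨t, ht⟩ := hA.exists
    exact nonneg_of_mul_nonneg_right ((hN0 t).trans ht) hϱ
  set A := funA v ϱ
  have hslice : ∀ᵐ t ∂volume.restrict (timeI r), ∫ x in ballB r, ‖v x t‖ ^ 3 ≤
      C * ((ϱ * A) ^ (3 / 4 : ℝ) * D t ^ (3 / 4 : ℝ) +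
        (r / ϱ) ^ 3 * ϱ ^ (-3 / 2 : ℝ) * (ϱ * A) ^ (3 / 2 : ℝ)) := by
    have h := ae_restrict_of_ae_restrict_of_subset hI1 hv.ae_slice
    filter_upwards [ae_restrict_of_ae_restrict_of_subset hI (h.and hA)]
      with t ⟨⟨h1, h2, h3, h4⟩, h5⟩
    refine (hC (fun x => v x t) (fun x => gv x t) r ϱ hr hrϱ
      (h1.mono_measure (Measure.restrict_mono_set _ hB1)) (h2.mono_set hB1) (h3.mono_set hB1)
      fun ψ hψ hψs i j => ?_).trans ?_
    · have hψ0 : ∀ x ∈ ballB 1 \ ballB ϱ, x ∉ tsupport ψ := fun x hx hxs => hx.2 (hψs hxs)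
      have e1 := setIntegral_eq_of_subset_of_forall_sdiff_eq_zero (μ := volume)
        (f := fun x => v x t i * fderiv ℝ ψ x (EuclideanSpace.single j (1 : ℝ)))
        measurableSet_ball hB1 fun x hx => by
          simp [image_eq_zero_of_notMem_tsupport
            (fun h => hψ0 x hx (tsupport_fderiv_subset ℝ h))]
      have e2 := setIntegral_eq_of_subset_of_forall_sdiff_eq_zero (μ := volume)
        (f := fun x => gv x t i j * ψ x)
        measurableSet_ball hB1 fun x hx => by
          simp [image_eq_zero_of_notMem_tsupport (hψ0 x hx)]
      exact (e1.symm.trans (h4 ψ hψ (hψs.trans hB1) i j)).trans (congrArg _ e2)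
    · have := hN0 t
      have := hD0 t
      change C * (N t ^ (3 / 4 : ℝ) * D t ^ (3 / 4 : ℝ) + _ * N t ^ (3 / 2 : ℝ)) ≤ _
      gcongr
  have : IsFiniteMeasure (volume.restrict (timeI r)) :=
    isFiniteMeasure_restrict.2 measure_Ioo_lt_top.ne
  have hvol : (volume.restrict (timeI r)).real univ = r ^ 2 := by
    simp [timeI, Measure.real, ENNReal.toReal_ofReal, sq_nonneg]
  have hDr := hDi.mono_set hI
  have hDp := integrable_rpow_of_le_one hDr hD0 (p := 3 / 4) (by norm_num) (by norm_num)
  have hDE : ∫ t in timeI r, D t ^ (3 / 4 : ℝ) ≤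
      r ^ (1 / 2 : ℝ) * (ϱ * funE gv ϱ) ^ (3 / 4 : ℝ) := by
    refine (integral_rpow_three_quarters_le hDr hD0).trans ?_
    have e1 : ϱ * funE gv ϱ = ∫ t in timeI ϱ, D t := by
      rw [funE, ← mul_assoc, mul_one_div_cancel hϱ.ne', one_mul]
    rw [hvol, e1, ← Real.rpow_natCast, ← Real.rpow_mul hr.le]
    norm_num
    gcongr
    exact .of_forall hD0
  have hE0 : 0 ≤ funE gv ϱ := mul_nonneg (by positivity) (integral_nonneg hD0)
  have hint : ∫ t in timeI r, ∫ x in ballB r, ‖v x t‖ ^ 3 ≤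
      C * ((ϱ * A) ^ (3 / 4 : ℝ) * (r ^ (1 / 2 : ℝ) * (ϱ * funE gv ϱ) ^ (3 / 4 : ℝ)) +
        r ^ 2 * ((r / ϱ) ^ 3 * ϱ ^ (-3 / 2 : ℝ) * (ϱ * A) ^ (3 / 2 : ℝ))) := by
    refine (integral_mono_of_nonneg (.of_forall fun t => integral_nonneg fun x => by positivity)
      (((hDp.const_mul _).add (integrable_const _)).const_mul C) hslice).trans ?_
    simp only [Pi.add_apply]
    rw [integral_const_mul, integral_add (hDp.const_mul _) (integrable_const _),
      integral_const_mul, integral_const, hvol, smul_eq_mul]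
    gcongr
  set E := funE gv ϱ
  have hs : 1 ≤ ϱ / r := (one_le_div hr).2 hrϱ
  have e1 : 1 / r ^ 2 * ((ϱ * A) ^ (3 / 4 : ℝ) * (r ^ (1 / 2 : ℝ) * (ϱ * E) ^ (3 / 4 : ℝ))) =
      (ϱ / r) ^ (3 / 2 : ℝ) * (A ^ (3 / 4 : ℝ) * E ^ (3 / 4 : ℝ)) := by
    have h1 : ϱ ^ (3 / 4 : ℝ) * ϱ ^ (3 / 4 : ℝ) = ϱ ^ (3 / 2 : ℝ) := by
      rw [← Real.rpow_add hϱ]; norm_num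
    have h2 : r ^ (1 / 2 : ℝ) * r ^ (3 / 2 : ℝ) = r ^ 2 := by
      rw [← Real.rpow_add hr]; norm_num
    rw [Real.mul_rpow hϱ.le hA0, Real.mul_rpow hϱ.le hE0, Real.div_rpow hϱ.le hr.le, ← h1, ← h2]
    field_simp
  have e2 : 1 / r ^ 2 * (r ^ 2 * ((r / ϱ) ^ 3 * ϱ ^ (-3 / 2 : ℝ) * (ϱ * A) ^ (3 / 2 : ℝ))) =
      (r / ϱ) ^ 3 * A ^ (3 / 2 : ℝ) := by
    have h1 : ϱ ^ (-3 / 2 : ℝ) * ϱ ^ (3 / 2 : ℝ) = 1 := by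
      rw [← Real.rpow_add hϱ]; norm_num
    rw [Real.mul_rpow hϱ.le hA0, ← mul_assoc, one_div_mul_cancel (by positivity), one_mul,
      mul_assoc, ← mul_assoc (ϱ ^ (-3 / 2 : ℝ)), h1, one_mul]
  have e3 : (ϱ / r) ^ (3 / 2 : ℝ) ≤ (ϱ / r) ^ 3 := by
    rw [← Real.rpow_natCast]
    exact Real.rpow_le_rpow_of_exponent_le hs (by norm_num)
  calc funC v r ≤ 1 / r ^ 2 * (C * ((ϱ * A) ^ (3 / 4 : ℝ) *
        (r ^ (1 / 2 : ℝ) * (ϱ * E) ^ (3 / 4 : ℝ)) +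
        r ^ 2 * ((r / ϱ) ^ 3 * ϱ ^ (-3 / 2 : ℝ) * (ϱ * A) ^ (3 / 2 : ℝ)))) := by
        unfold funC
        gcongr
    _ = C * ((ϱ / r) ^ (3 / 2 : ℝ) * (A ^ (3 / 4 : ℝ) * E ^ (3 / 4 : ℝ)) +
        (r / ϱ) ^ 3 * A ^ (3 / 2 : ℝ)) := by
        rw [← e1, ← e2]
        ring
    _ ≤ _ := by
        rw [mul_assoc ((ϱ / r) ^ 3)]
        gcongr
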